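/- arXiv:1609.08006 — 9 statements merged into one kernel-verified Lean document; each statement's English description precedes it below -/
import Mathlib

section
/- For all real numbers x, y, t, the series Σ_{n=0}^∞ (t^n / n!) · H_n(x,y) converges absolutely and equals e^{x t + y t²}. -/
open Real

/-- Two-variable Hermite (Kampé de Fériet) polynomials
`H_n(x,y) = n! ∑_{s=0}^{⌊n/2⌋} x^(n-2s) y^s / ((n-2s)! s!)`. -/
noncomputable def hermite2 (n : ℕ) (x y : ℝ) : ℝ :=
  (n.factorial : ℝ) * ∑ s ∈ Finset.range (n / 2 + 1),
    x ^ (n - 2 * s) * y ^ s / ((Nat.factorial (n - 2 * s) : ℝ) * (Nat.factorial s : ℝ))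

/-- The exponential series in `y t²`, spread over the even indices. -/
noncomputable def evenPart (z : ℝ) (m : ℕ) : ℝ :=
  if m % 2 = 0 then z ^ (m / 2) / (Nat.factorial (m / 2) : ℝ) else 0

lemma evenPart_two_mul (z : ℝ) (s : ℕ) :
    evenPart z (2 * s) = z ^ s / (Nat.factorial s : ℝ) := by
  simp [evenPart]

lemma two_mul_inj : Function.Injective (fun s : ℕ => 2 * s) := by
  intro a b h
  simp only at h
  omega

lemma evenPart_zero (z : ℝ) (m : ℕ) (hm : m ∉ Set.range (fun s : ℕ => 2 * s)) :
    evenPart z m = 0 := by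
  unfold evenPart
  rw [if_neg]
  intro h
  exact hm ⟨m / 2, by simp only; omega⟩

lemma exp_hasSum (z : ℝ) : HasSum (fun n : ℕ => z ^ n / (Nat.factorial n : ℝ)) (Real.exp z) := by
  rw [Real.exp_eq_exp_ℝ]
  exact NormedSpace.expSeries_div_hasSum_exp z

lemma evenPart_hasSum (z : ℝ) : HasSum (evenPart z) (Real.exp z) := by
  rw [← two_mul_inj.hasSum_iff (evenPart_zero z)]
  convert exp_hasSum z using 1
  funext s
  exact evenPart_two_mul z s

lemma term_eq (x y t : ℝ) (n : ℕ) :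
    t ^ n / (Nat.factorial n : ℝ) * hermite2 n x y =
      ∑ kl ∈ Finset.HasAntidiagonal.antidiagonal n, evenPart (y * t ^ 2) kl.1 *
        ((x * t) ^ kl.2 / (Nat.factorial kl.2 : ℝ)) := by
  rw [Finset.Nat.sum_antidiagonal_eq_sum_range_succ
    (fun i j => evenPart (y * t ^ 2) i * ((x * t) ^ j / (Nat.factorial j : ℝ))) n]
  have hn : (Nat.factorial n : ℝ) ≠ 0 := by positivity
  rw [hermite2, ← mul_assoc, div_mul_cancel₀ _ hn, Finset.mul_sum]
  refine Finset.sum_of_injOn (fun s : ℕ => 2 * s) two_mul_inj.injOn ?_ ?_ ?_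
  · intro s hs
    simp only [Finset.coe_range, Set.mem_Iio] at hs ⊢
    omega
  · intro m hm hm'
    rw [evenPart_zero, zero_mul]
    rintro ⟨s, rfl⟩
    apply hm'
    refine ⟨s, ?_, rfl⟩
    simp only [Finset.coe_range, Set.mem_Iio, Finset.mem_range] at hm ⊢
    omega
  · intro s hs
    simp only [Finset.mem_range] at hs
    have h : t ^ n = (t ^ 2) ^ s * t ^ (n - 2 * s) := by
      rw [← pow_mul, ← pow_add]
      congr 1
      omega
    simp only [evenPart_two_mul]
    rw [h, mul_pow, mul_pow]
    field_simp

theorem generating_function_hermite2 (x y t : ℝ) :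
    Summable (fun n : ℕ => |t ^ n / (Nat.factorial n : ℝ) * hermite2 n x y|) ∧
    ∑' n : ℕ, t ^ n / (Nat.factorial n : ℝ) * hermite2 n x y
      = Real.exp (x * t + y * t ^ 2) := by
  have hf : Summable (fun m => ‖evenPart (y * t ^ 2) m‖) := (evenPart_hasSum _).summable.norm
  have hg : Summable (fun m : ℕ => ‖(x * t) ^ m / (Nat.factorial m : ℝ)‖) :=
    (exp_hasSum _).summable.norm
  simp only [term_eq]
  have h1 := summable_norm_sum_mul_antidiagonal_of_summable_norm hf hg
  simp only [Real.norm_eq_abs] at h1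
  refine ⟨h1, ?_⟩
  rw [← tsum_mul_tsum_eq_tsum_sum_antidiagonal_of_summable_norm hf hg,
    (evenPart_hasSum _).tsum_eq, (exp_hasSum _).tsum_eq, ← Real.exp_add, add_comm]
end

section
/- Let α > 0, let β be real with |β| < α, and let γ be real. Then ∫_{-∞}^{∞} e^{-(α+β)x² - γx} dx = √(π/α) · Σ_{r=0}^∞ (1/r!) · H_{2r}(γ/(2√α), -β/(4α)), where the series on the right converges absolutely; moreover both sides equal √(π/(α+β)) · e^{γ²/(4(α+β))}. -/
open Real MeasureTheory

/-- The double series term. -/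
noncomputable def dterm (x y : ℝ) (p : ℕ × ℕ) : ℝ :=
  x ^ (2 * p.1) * y ^ p.2 * ((2 * (p.1 + p.2)).factorial : ℝ) /
    ((p.1 + p.2).factorial * (2 * p.1).factorial * p.2.factorial)

theorem fact_asc (k s : ℕ) :
    ((2 * (k + s)).factorial : ℝ) / ((k + s).factorial * (2 * k).factorial)
      = 4 ^ s * (ascPochhammer ℝ s).eval ((k : ℝ) + 1 / 2) / k.factorial := by
  induction s with
  | zero =>
    simp
    field_simp
  | succ s ih =>
    rw [ascPochhammer_succ_eval]
    have h1 : (2 * (k + (s + 1))).factorial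
        = (2 * (k + s) + 2) * ((2 * (k + s) + 1) * (2 * (k + s)).factorial) := by
      rw [show 2 * (k + (s + 1)) = 2 * (k + s) + 1 + 1 by ring, Nat.factorial_succ,
        Nat.factorial_succ]
    have h2 : (k + (s + 1)).factorial = (k + s + 1) * (k + s).factorial := by
      rw [← add_assoc, Nat.factorial_succ]
    rw [h1, h2]
    have hk : (k.factorial : ℝ) ≠ 0 := by positivity
    have hks : ((k + s).factorial : ℝ) ≠ 0 := by positivity
    have h2k : ((2 * k).factorial : ℝ) ≠ 0 := by positivity
    have hp : (k : ℝ) + s + 1 ≠ 0 := by positivity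
    have e : (((2 * (k + s) + 2) * ((2 * (k + s) + 1) * (2 * (k + s)).factorial) : ℕ) : ℝ)
        / (((k + s + 1) * (k + s).factorial : ℕ) * (2 * k).factorial)
        = (2 * (2 * ((k : ℝ) + s) + 1)) *
          (((2 * (k + s)).factorial : ℝ) / ((k + s).factorial * (2 * k).factorial)) := by
      push_cast
      field_simp
    rw [e, ih, pow_succ]
    ring

theorem binom_sum (a z : ℝ) (hz : |z| < 1) :
    HasSum (fun s : ℕ => (ascPochhammer ℝ s).eval a / s.factorial * z ^ s)
      (1 / (1 - z) ^ a) := by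
  have h := (Real.one_div_one_sub_rpow_hasFPowerSeriesOnBall_zero a).hasSum (y := z) (by
    simp
    rw [← ofReal_norm]
    simpa using hz)
  simp only [zero_add, FormalMultilinearSeries.ofScalars_apply_eq, smul_eq_mul] at h
  suffices hf : (fun s : ℕ => (ascPochhammer ℝ s).eval a / s.factorial * z ^ s)
      = fun n : ℕ => Ring.choose (a + n - 1) n * z ^ n by
    rw [hf]; exact h
  funext s
  congr 1
  have := Ring.factorial_nsmul_multichoose_eq_ascPochhammer a s
  rw [Polynomial.ascPochhammer_smeval_eq_eval, nsmul_eq_mul] at this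
  rw [← this, Ring.choose, show a + (s : ℝ) - 1 - s + 1 = a by ring]
  have hs : (s.factorial : ℝ) ≠ 0 := by positivity
  field_simp

theorem dterm_inner (x y : ℝ) (hy : |4 * y| < 1) (k : ℕ) :
    HasSum (fun s => dterm x y (k, s))
      (1 / (1 - 4 * y) ^ (1 / 2 : ℝ) * ((x ^ 2 / (1 - 4 * y)) ^ k / k.factorial)) := by
  have h := (binom_sum ((k : ℝ) + 1 / 2) (4 * y) hy).mul_left (x ^ (2 * k) / k.factorial)
  have hp : 0 < 1 - 4 * y := by linarith [(abs_lt.1 hy).2]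
  convert h using 1
  · rfl
  · funext s
    have := fact_asc k s
    simp only [dterm]
    rw [mul_pow]
    calc _ = x ^ (2 * k) * y ^ s / s.factorial * (((2 * (k + s)).factorial : ℝ) / ((k + s).factorial * (2 * k).factorial)) := by
            field_simp
      _ = _ := by rw [this]; field_simp
  · rw [Real.rpow_add hp, Real.rpow_natCast, div_pow, pow_mul]
    field_simp

theorem dterm_abs (x y : ℝ) (p : ℕ × ℕ) : |dterm x y p| = dterm |x| |y| p := by
  simp [dterm, abs_div, abs_mul, abs_pow]

theorem dterm_summable_abs (x y : ℝ) (hy : |4 * y| < 1) :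
    Summable (fun p => |dterm x y p|) := by
  simp_rw [dterm_abs]
  have hy' : |4 * (|y|)| < 1 := by
    rw [abs_mul, abs_abs, ← abs_mul]; exact hy
  refine (summable_prod_of_nonneg (fun p => ?_)).2 ⟨fun k => (dterm_inner |x| |y| hy' k).summable, ?_⟩
  · show 0 ≤ dterm |x| |y| p
    rw [← dterm_abs]; positivity
  · simp_rw [fun k => (dterm_inner |x| |y| hy' k).tsum_eq]
    exact (Real.summable_pow_div_factorial _).mul_left _

theorem dterm_hasSum (x y : ℝ) (hy : |4 * y| < 1) :
    HasSum (dterm x y) (1 / (1 - 4 * y) ^ (1 / 2 : ℝ) * Real.exp (x ^ 2 / (1 - 4 * y))) := by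
  have h := (dterm_summable_abs x y hy).of_abs.hasSum
  have h2 := h.prod_fiberwise (dterm_inner x y hy)
  have h3 : HasSum (fun k : ℕ => (x ^ 2 / (1 - 4 * y)) ^ k / (k.factorial : ℝ))
      (Real.exp (x ^ 2 / (1 - 4 * y))) := by
    rw [Real.exp_eq_exp_ℝ]
    exact NormedSpace.expSeries_div_hasSum_exp _
  rw [h2.unique (h3.mul_left _)] at h
  exact h

theorem herm_eq (x y : ℝ) (r : ℕ) :
    (1 / (r.factorial : ℝ)) * hermite2 (2 * r) x y
      = ∑ p ∈ Finset.HasAntidiagonal.antidiagonal r, dterm x y p := by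
  rw [← Finset.Nat.sum_antidiagonal_swap, Finset.Nat.sum_antidiagonal_eq_sum_range_succ_mk, hermite2, ← mul_assoc, Finset.mul_sum]
  rw [show 2 * r / 2 + 1 = r.succ by omega]
  refine Finset.sum_congr rfl fun s hs => ?_
  have hs' : s ≤ r := by simpa [Nat.lt_succ_iff] using hs
  simp only [dterm, Prod.swap]
  rw [Nat.sub_add_cancel hs', Nat.mul_sub]
  field_simp

theorem herm_summable (x y : ℝ) (hy : |4 * y| < 1) :
    Summable (fun r : ℕ => |(1 / (r.factorial : ℝ)) * hermite2 (2 * r) x y|) := by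
  have h := dterm_summable_abs x y hy
  rw [← Finset.HasAntidiagonal.sigmaAntidiagonalEquivProd.summable_iff] at h
  have h2 := h.sigma
  refine Summable.of_nonneg_of_le (fun _ => abs_nonneg _) (fun r => ?_) h2
  rw [herm_eq, tsum_fintype]
  refine (Finset.abs_sum_le_sum_abs _ _).trans (le_of_eq ?_)
  exact (Finset.sum_coe_sort (Finset.HasAntidiagonal.antidiagonal r) (fun p => |dterm x y p|)).symm

theorem herm_hasSum (x y : ℝ) (hy : |4 * y| < 1) :
    HasSum (fun r : ℕ => (1 / (r.factorial : ℝ)) * hermite2 (2 * r) x y)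
      (1 / (1 - 4 * y) ^ (1 / 2 : ℝ) * Real.exp (x ^ 2 / (1 - 4 * y))) := by
  have h := dterm_hasSum x y hy
  rw [← Finset.HasAntidiagonal.sigmaAntidiagonalEquivProd.hasSum_iff] at h
  refine h.sigma fun r => ?_
  rw [herm_eq, ← Finset.sum_coe_sort (Finset.HasAntidiagonal.antidiagonal r) (dterm x y)]
  exact hasSum_fintype _

theorem gauss_int (c γ : ℝ) (hc : 0 < c) :
    (∫ x : ℝ, Real.exp (-c * x ^ 2 - γ * x))
      = Real.sqrt (π / c) * Real.exp (γ ^ 2 / (4 * c)) := by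
  rw [← integral_gaussian, ← integral_mul_const,
    ← integral_add_right_eq_self (fun x : ℝ => Real.exp (-c * x ^ 2) * Real.exp (γ ^ 2 / (4 * c))) (γ / (2 * c))]
  congr 1
  ext x
  rw [← Real.exp_add]
  congr 1
  field_simp
  ring

theorem gaussian_integral_via_hermite2 (α β γ : ℝ) (hα : 0 < α) (hβ : |β| < α) :
    Summable (fun r : ℕ => |(1 / (Nat.factorial r : ℝ)) *
        hermite2 (2 * r) (γ / (2 * Real.sqrt α)) (-β / (4 * α))|) ∧
    (∫ x : ℝ, Real.exp (-(α + β) * x ^ 2 - γ * x))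
      = Real.sqrt (π / α) * ∑' r : ℕ, (1 / (Nat.factorial r : ℝ)) *
          hermite2 (2 * r) (γ / (2 * Real.sqrt α)) (-β / (4 * α)) ∧
    (∫ x : ℝ, Real.exp (-(α + β) * x ^ 2 - γ * x))
      = Real.sqrt (π / (α + β)) * Real.exp (γ ^ 2 / (4 * (α + β))) := by
  have hc : 0 < α + β := by linarith [(abs_lt.1 hβ).1]
  have e4 : 4 * (-β / (4 * α)) = -(β / α) := by field_simp
  have hy : |4 * (-β / (4 * α))| < 1 := by
    rw [e4, abs_neg, abs_div, abs_of_pos hα, div_lt_one hα]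
    exact hβ
  refine ⟨herm_summable _ _ hy, ?_, gauss_int _ _ hc⟩
  rw [gauss_int _ _ hc, (herm_hasSum _ _ hy).tsum_eq, e4]
  have e5 : 1 - -(β / α) = (α + β) / α := by field_simp; ring
  rw [e5, ← Real.sqrt_eq_rpow, ← mul_assoc, mul_one_div, ← Real.sqrt_div' _ (by positivity)]
  congr 2
  · field_simp
  · rw [div_pow, mul_pow, Real.sq_sqrt hα.le]
    field_simp
    ring
end

section
/- For every natural number l and all real numbers x, y, t, the series Σ_{n=0}^∞ (t^n / n!) · H_{n+l}(x,y) converges absolutely and equals H_l(x + 2yt, y) · e^{x t + y t²}. -/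
open Real

noncomputable def hmA (x : ℝ) (k : ℕ) : ℝ := x ^ k / (k.factorial : ℝ)

noncomputable def hmB (y : ℝ) (m : ℕ) : ℝ :=
  if Even m then y ^ (m / 2) / ((m / 2).factorial : ℝ) else 0

lemma hm_eq (n : ℕ) (x y : ℝ) : hermite2 n x y =
    (n.factorial : ℝ) * ∑ p ∈ Finset.HasAntidiagonal.antidiagonal n, hmA x p.1 * hmB y p.2 := by
  unfold hermite2
  congr 1
  symm
  rw [← Finset.sum_filter_add_sum_filter_not _ (fun p : ℕ × ℕ => Even p.2)]
  rw [Finset.sum_eq_zero (s := Finset.filter (fun p : ℕ × ℕ => ¬ Even p.2) _), add_zero]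
  · symm
    refine Finset.sum_bij' (fun s _ => (n - 2 * s, 2 * s)) (fun p _ => p.2 / 2) ?_ ?_ ?_ ?_ ?_
    · intro s hs
      simp only [Finset.mem_range] at hs
      simp
      omega
    · rintro ⟨a, b⟩ hp
      simp at hp
      simp
      omega
    · intro s hs
      simp
    · rintro ⟨a, b⟩ hp
      simp only [Finset.mem_filter, Finset.HasAntidiagonal.mem_antidiagonal, Nat.even_iff] at hp
      ext <;> simp <;> omega
    · intro s hs
      simp [hmA, hmB]
      field_simp
  · rintro ⟨a, b⟩ hp
    simp only [Finset.mem_filter] at hp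
    simp [hmB, hp.2]

lemma hmB_succ (y : ℝ) (m : ℕ) : ((m : ℝ) + 2) * hmB y (m + 2) = 2 * y * hmB y m := by
  unfold hmB
  by_cases h : Even m
  · obtain ⟨k, rfl⟩ := h
    have h1 : (k + k) / 2 = k := by omega
    have h2 : (k + k + 2) / 2 = k + 1 := by omega
    have h3 : Even (k + k + 2) := ⟨k + 1, by omega⟩
    rw [if_pos h3, if_pos ⟨k, rfl⟩, h1, h2, Nat.factorial_succ]
    push_cast
    field_simp
    ring
  · have h3 : ¬ Even (m + 2) := by
      simpa [Nat.even_add] using h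
    simp [h, h3]

lemma hmA_succ (x : ℝ) (m : ℕ) : ((m : ℝ) + 1) * hmA x (m + 1) = x * hmA x m := by
  unfold hmA
  rw [Nat.factorial_succ]
  push_cast
  field_simp
  ring

open PowerSeries in
lemma hm_deriv (x y : ℝ) :
    PowerSeries.derivative ℝ (PowerSeries.mk (hmA x) * PowerSeries.mk (hmB y)) =
      PowerSeries.C x * (PowerSeries.mk (hmA x) * PowerSeries.mk (hmB y)) +
      PowerSeries.C (2 * y) * (PowerSeries.X * (PowerSeries.mk (hmA x) * PowerSeries.mk (hmB y))) := by
  have hA : PowerSeries.derivative ℝ (PowerSeries.mk (hmA x)) =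
      PowerSeries.C x * PowerSeries.mk (hmA x) := by
    ext n
    rw [PowerSeries.coeff_derivative, PowerSeries.coeff_C_mul, PowerSeries.coeff_mk,
      PowerSeries.coeff_mk, ← hmA_succ]
    ring
  have hB : PowerSeries.derivative ℝ (PowerSeries.mk (hmB y)) =
      PowerSeries.C (2 * y) * (PowerSeries.X * PowerSeries.mk (hmB y)) := by
    ext n
    rw [PowerSeries.coeff_derivative, PowerSeries.coeff_C_mul, PowerSeries.coeff_mk]
    cases n with
    | zero => simp [hmB]
    | succ n =>
      rw [PowerSeries.coeff_succ_X_mul, PowerSeries.coeff_mk, ← hmB_succ]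
      push_cast
      ring
  rw [Derivation.leibniz, hA, hB]
  simp only [smul_eq_mul]
  ring

lemma hm_coeff (n : ℕ) (x y : ℝ) : hermite2 n x y = (n.factorial : ℝ) *
    PowerSeries.coeff n (PowerSeries.mk (hmA x) * PowerSeries.mk (hmB y)) := by
  rw [hm_eq, PowerSeries.coeff_mul]
  simp

lemma hm_rec (n : ℕ) (x y : ℝ) : hermite2 (n + 2) x y =
    x * hermite2 (n + 1) x y + 2 * y * (n + 1) * hermite2 n x y := by
  have h := congrArg (PowerSeries.coeff (n + 1)) (hm_deriv x y)
  rw [PowerSeries.coeff_derivative, map_add, PowerSeries.coeff_C_mul, PowerSeries.coeff_C_mul,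
    PowerSeries.coeff_succ_X_mul] at h
  rw [hm_coeff, hm_coeff, hm_coeff, Nat.factorial_succ (n + 1), Nat.factorial_succ n]
  push_cast at h ⊢
  linear_combination ((n : ℝ) + 1) * (n.factorial : ℝ) * h

lemma hm_zero (x y : ℝ) : hermite2 0 x y = 1 := by simp [hermite2]
lemma hm_one (x y : ℝ) : hermite2 1 x y = x := by simp [hermite2]

lemma hmA_hasSum (x : ℝ) : HasSum (hmA x) (Real.exp x) := by
  rw [Real.exp_eq_exp_ℝ]
  exact NormedSpace.expSeries_div_hasSum_exp x

lemma hmB_hasSum (y : ℝ) : HasSum (hmB y) (Real.exp y) := by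
  have hi : Function.Injective (fun k : ℕ => 2 * k) := fun a b h => by simpa using h
  rw [← hi.hasSum_iff]
  · convert hmA_hasSum y using 1
    ext k
    simp [hmA, hmB]
  · intro m hm
    have : ¬ Even m := by
      rintro ⟨k, rfl⟩
      exact hm ⟨k, by simp; omega⟩
    simp [hmB, this]

lemma hm_congr {f g : ℕ → ℝ} {a b : ℝ} (h : HasSum g b) (hf : ∀ n, f n = g n) (hab : a = b) :
    HasSum f a := by
  have : f = g := funext hf
  rw [this, hab]
  exact h

lemma hm_base (x y t : ℝ) :
    HasSum (fun n : ℕ => t ^ n / (Nat.factorial n : ℝ) * hermite2 n x y)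
      (Real.exp (x * t + y * t ^ 2)) := by
  have ha := hmA_hasSum (x * t)
  have hb := hmB_hasSum (y * t ^ 2)
  have h1 := (summable_norm_sum_mul_antidiagonal_of_summable_norm ha.summable.norm
    hb.summable.norm).of_norm.hasSum
  rw [← tsum_mul_tsum_eq_tsum_sum_antidiagonal_of_summable_norm ha.summable.norm
    hb.summable.norm, ha.tsum_eq, hb.tsum_eq, ← Real.exp_add] at h1
  refine hm_congr h1 (fun n => ?_) rfl
  rw [hm_eq, ← mul_assoc, div_mul_cancel₀ _ (by positivity), Finset.mul_sum]
  refine Finset.sum_congr rfl ?_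
  rintro ⟨i, j⟩ hij
  rw [Finset.HasAntidiagonal.mem_antidiagonal] at hij
  simp only at hij
  subst hij
  simp only [hmA, hmB]
  split_ifs with h
  · obtain ⟨k, rfl⟩ := h
    have h1 : (k + k) / 2 = k := by omega
    rw [h1, mul_pow, mul_pow]
    ring
  · simp

/-- Shifted term. -/
lemma hm_shift (x y t S : ℝ) (l : ℕ)
    (h : HasSum (fun n : ℕ => t ^ n / (Nat.factorial n : ℝ) * hermite2 (n + (l + 1)) x y) S) :
    HasSum (fun n : ℕ => n * (t ^ n / (Nat.factorial n : ℝ) * hermite2 (n + l) x y)) (t * S) := by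
  rw [← hasSum_nat_add_iff' 1]
  simp only [Finset.range_one, Finset.sum_singleton, Nat.cast_zero, zero_mul, sub_zero]
  refine hm_congr (h.mul_left t) (fun n => ?_) rfl
  rw [Nat.factorial_succ, show n + 1 + l = n + (l + 1) by ring]
  push_cast
  field_simp
  try ring

lemma hm_hasSum (x y t : ℝ) (l : ℕ) :
    HasSum (fun n : ℕ => t ^ n / (Nat.factorial n : ℝ) * hermite2 (n + l) x y)
      (hermite2 l (x + 2 * y * t) y * Real.exp (x * t + y * t ^ 2)) ∧
    HasSum (fun n : ℕ => t ^ n / (Nat.factorial n : ℝ) * hermite2 (n + (l + 1)) x y)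
      (hermite2 (l + 1) (x + 2 * y * t) y * Real.exp (x * t + y * t ^ 2)) := by
  induction l with
  | zero =>
    have h0 := hm_base x y t
    refine ⟨by simpa [hm_zero] using h0, ?_⟩
    rw [zero_add, hm_one, ← hasSum_nat_add_iff' 1]
    have h0' := (hasSum_nat_add_iff' 1).2 h0
    have h2 := (h0'.mul_left x).add (h0.mul_left (2 * y * t))
    refine hm_congr h2 (fun n => ?_) ?_
    · rw [show n + 1 + 1 = n + 2 by ring, hm_rec, Nat.factorial_succ]
      push_cast
      field_simp
      ring
    · simp [hm_zero, hm_one]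
      ring
  | succ l ih =>
    refine ⟨ih.2, ?_⟩
    have h3 := hm_shift x y t _ l ih.2
    have h4 := ((ih.2.mul_left x).add (ih.1.mul_left (2 * y * (l + 1)))).add (h3.mul_left (2 * y))
    refine hm_congr h4 (fun n => ?_) ?_
    · rw [show n + (l + 1 + 1) = (n + l) + 2 by ring, hm_rec]
      rw [show n + (l + 1) = n + l + 1 by ring]
      push_cast
      ring
    · rw [show l + 1 + 1 = l + 2 by ring, hm_rec]
      ring

theorem shifted_generating_function_hermite2 (l : ℕ) (x y t : ℝ) :
    Summable (fun n : ℕ => |t ^ n / (Nat.factorial n : ℝ) * hermite2 (n + l) x y|) ∧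
    ∑' n : ℕ, t ^ n / (Nat.factorial n : ℝ) * hermite2 (n + l) x y
      = hermite2 l (x + 2 * y * t) y * Real.exp (x * t + y * t ^ 2) := by
  have h := (hm_hasSum x y t l).1
  exact ⟨h.summable.abs, h.tsum_eq⟩
end

section
/- For all real γ, β, every natural number n, and every real x, the n-th derivative of the function x ↦ e^{-(γx² + βx⁴)} is given by d^n/dx^n e^{-(γx² + βx⁴)} = (-1)^n · n! · Σ_{r=0}^{⌊n/2⌋} (-1)^r (2x)^{n-2r} / ((n-2r)! r!) · H_{n-r}(γ + 2βx², -β) · e^{-(γx² + βx⁴)}. -/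
open Real

/-- The coefficient `n! / ((n-2s)! s!)`, extended by zero. -/
noncomputable def hcoef (n s : ℕ) : ℝ :=
  if 2 * s ≤ n then (n.factorial : ℝ) / ((Nat.factorial (n - 2 * s) : ℝ) * (Nat.factorial s : ℝ))
  else 0

lemma hcoef_of_le {n s : ℕ} (h : 2 * s ≤ n) : hcoef n s =
    (n.factorial : ℝ) / ((Nat.factorial (n - 2 * s) : ℝ) * (Nat.factorial s : ℝ)) := if_pos h

lemma hcoef_of_lt {n s : ℕ} (h : n < 2 * s) : hcoef n s = 0 := if_neg (by omega)

lemma hcoef_zero (n : ℕ) : hcoef n 0 = 1 := by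
  rw [hcoef_of_le (by omega)]
  have := Nat.factorial_ne_zero n
  simp [this]

lemma hcoef_succ (n s : ℕ) :
    hcoef (n + 1) (s + 1) = hcoef n (s + 1) + 2 * ((n - 2 * s : ℕ) : ℝ) * hcoef n s := by
  rcases Nat.lt_or_ge n (2 * s + 2) with h | h
  · rcases Nat.lt_or_ge n (2 * s + 1) with h1 | h1
    · rw [hcoef_of_lt (by omega), hcoef_of_lt (by omega), Nat.sub_eq_zero_of_le (by omega)]
      simp
    · obtain rfl : n = 2 * s + 1 := by omega
      rw [hcoef_of_le (by omega), hcoef_of_lt (by omega), hcoef_of_le (by omega)]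
      rw [show 2 * s + 1 + 1 - 2 * (s + 1) = 0 by omega, show 2 * s + 1 - 2 * s = 1 by omega,
        Nat.factorial_succ (2 * s + 1), Nat.factorial_succ s]
      have := Nat.factorial_ne_zero s
      push_cast
      simp only [Nat.factorial_zero, Nat.factorial_one, Nat.cast_one]
      field_simp
      ring
  · obtain ⟨k, rfl⟩ := Nat.exists_eq_add_of_le h
    rw [hcoef_of_le (by omega), hcoef_of_le (by omega), hcoef_of_le (by omega)]
    rw [show 2 * s + 2 + k + 1 - 2 * (s + 1) = k + 1 by omega,
      show 2 * s + 2 + k - 2 * (s + 1) = k by omega,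
      show 2 * s + 2 + k - 2 * s = k + 1 + 1 by omega,
      Nat.factorial_succ (2 * s + 2 + k), Nat.factorial_succ s, Nat.factorial_succ (k + 1),
      Nat.factorial_succ k]
    have := Nat.factorial_ne_zero s
    have := Nat.factorial_ne_zero k
    push_cast
    field_simp
    ring

lemma hcoef_sum_succ (n : ℕ) (F : ℕ → ℝ) :
    ∑ r ∈ Finset.range (n + 2), hcoef (n + 1) r * F r =
      ∑ r ∈ Finset.range (n + 1),
        hcoef n r * (F r + 2 * ((n - 2 * r : ℕ) : ℝ) * F (r + 1)) := by
  have h1 : ∑ r ∈ Finset.range (n + 1), hcoef n r * F r =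
      ∑ r ∈ Finset.range (n + 1), hcoef n (r + 1) * F (r + 1) + hcoef n 0 * F 0 := by
    rw [← Finset.sum_range_succ' (fun r => hcoef n r * F r), Finset.sum_range_succ _ (n + 1),
      hcoef_of_lt (show n < 2 * (n + 1) by omega)]
    simp
  simp only [mul_add, Finset.sum_add_distrib]
  rw [h1, Finset.sum_range_succ', hcoef_zero, hcoef_zero, add_right_comm,
    ← Finset.sum_add_distrib]
  congr 1
  refine Finset.sum_congr rfl fun r _ => ?_
  rw [hcoef_succ]
  ring

lemma sum_hcoef (n : ℕ) (F : ℕ → ℝ) :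
    (n.factorial : ℝ) * ∑ s ∈ Finset.range (n / 2 + 1),
      F s / ((Nat.factorial (n - 2 * s) : ℝ) * (Nat.factorial s : ℝ)) =
    ∑ s ∈ Finset.range (n + 1), hcoef n s * F s := by
  rw [Finset.mul_sum]
  rw [← Finset.sum_subset (Finset.range_subset_range.2 (show n / 2 + 1 ≤ n + 1 by omega))]
  · refine Finset.sum_congr rfl fun s hs => ?_
    rw [Finset.mem_range] at hs
    rw [hcoef_of_le (by omega)]
    ring
  · intro s _ hs
    rw [Finset.mem_range] at hs
    rw [hcoef_of_lt (by omega), zero_mul]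

lemma hermite2_eq (n : ℕ) (x y : ℝ) : hermite2 n x y =
    ∑ s ∈ Finset.range (n + 1), hcoef n s * (x ^ (n - 2 * s) * y ^ s) :=
  sum_hcoef n fun s => x ^ (n - 2 * s) * y ^ s

/-- `H_{n+1} = x H_n + 2 y ∂_x H_n`. -/
lemma hermite2_deriv (n : ℕ) (x y : ℝ) : ∃ D : ℝ,
    HasDerivAt (fun t => hermite2 n t y) D x ∧
      hermite2 (n + 1) x y = x * hermite2 n x y + 2 * y * D := by
  refine ⟨∑ s ∈ Finset.range (n + 1),
    hcoef n s * (((n - 2 * s : ℕ) : ℝ) * x ^ (n - 2 * s - 1) * y ^ s), ?_, ?_⟩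
  · simp only [hermite2_eq]
    exact HasDerivAt.fun_sum fun s _ => ((hasDerivAt_pow _ x).mul_const _).const_mul _
  · rw [hermite2_eq, hermite2_eq, hcoef_sum_succ, Finset.mul_sum, Finset.mul_sum,
      ← Finset.sum_add_distrib]
    refine Finset.sum_congr rfl fun s _ => ?_
    rcases Nat.lt_or_ge n (2 * s) with h | h
    · rw [hcoef_of_lt h]; simp
    · rw [show n + 1 - 2 * s = n - 2 * s + 1 by omega,
        show n + 1 - 2 * (s + 1) = n - 2 * s - 1 by omega]
      ring

/-- The `m`-th derivative of `exp (-(γ u + β u²))`. -/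
noncomputable def gder (γ β : ℝ) (m : ℕ) (u : ℝ) : ℝ :=
  (-1 : ℝ) ^ m * hermite2 m (γ + 2 * β * u) (-β) * Real.exp (-(γ * u + β * u ^ 2))

lemma gder_hasDerivAt (γ β : ℝ) (m : ℕ) (u : ℝ) :
    HasDerivAt (gder γ β m) (gder γ β (m + 1) u) u := by
  obtain ⟨D, hD, hrec⟩ := hermite2_deriv m (γ + 2 * β * u) (-β)
  have ha : HasDerivAt (fun u : ℝ => γ + 2 * β * u) (2 * β) u := by
    simpa using ((hasDerivAt_id u).const_mul (2 * β)).const_add γ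
  have he : HasDerivAt (fun u : ℝ => -(γ * u + β * u ^ 2)) (-(γ + β * (2 * u))) u := by
    have h := (((hasDerivAt_id' u).const_mul γ).fun_add ((hasDerivAt_pow 2 u).const_mul β)).fun_neg
    refine h.congr_deriv ?_
    norm_num
  have := ((hD.comp u ha).const_mul ((-1 : ℝ) ^ m)).mul he.exp
  refine this.congr_deriv ?_
  unfold gder
  rw [hrec]
  simp only [Function.comp_apply]
  ring

lemma iteratedDeriv_aux (γ β : ℝ) (n : ℕ) :
    iteratedDeriv n (fun x : ℝ => Real.exp (-(γ * x ^ 2 + β * x ^ 4))) =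
      fun x => ∑ r ∈ Finset.range (n + 1),
        hcoef n r * ((2 * x) ^ (n - 2 * r) * gder γ β (n - r) (x ^ 2)) := by
  induction n with
  | zero =>
    funext x
    simp [hcoef_zero, gder, hermite2, ← pow_mul]
  | succ n ih =>
    funext x
    rw [iteratedDeriv_succ, ih, hcoef_sum_succ]
    refine HasDerivAt.deriv (HasDerivAt.fun_sum fun r hr => ?_)
    rw [Finset.mem_range] at hr
    have h2 : HasDerivAt (fun x : ℝ => 2 * x) 2 x := by
      simpa using (hasDerivAt_id x).const_mul (2 : ℝ)
    have hs : HasDerivAt (fun x : ℝ => x ^ 2) (2 * x) x := by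
      simpa using hasDerivAt_pow 2 x
    have hg := HasDerivAt.comp x (gder_hasDerivAt γ β (n - r) (x ^ 2)) hs
    refine (((h2.fun_pow (n - 2 * r)).mul hg).const_mul (hcoef n r)).congr_deriv ?_
    rcases Nat.lt_or_ge n (2 * r) with h | h
    · rw [hcoef_of_lt h]; simp
    · rw [show n + 1 - 2 * r = n - 2 * r + 1 by omega,
        show n + 1 - 2 * (r + 1) = n - 2 * r - 1 by omega,
        show n + 1 - r = n - r + 1 by omega, show n + 1 - (r + 1) = n - r by omega]
      simp only [Function.comp_apply]
      ring

theorem iteratedDeriv_exp_quartic_via_hermite2 (γ β : ℝ) (n : ℕ) (x : ℝ) :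
    iteratedDeriv n (fun x : ℝ => Real.exp (-(γ * x ^ 2 + β * x ^ 4))) x
      = (-1 : ℝ) ^ n * (Nat.factorial n : ℝ) *
          (∑ r ∈ Finset.range (n / 2 + 1),
            (-1 : ℝ) ^ r * (2 * x) ^ (n - 2 * r) /
                ((Nat.factorial (n - 2 * r) : ℝ) * (Nat.factorial r : ℝ)) *
              hermite2 (n - r) (γ + 2 * β * x ^ 2) (-β)) *
          Real.exp (-(γ * x ^ 2 + β * x ^ 4)) := by
  rw [iteratedDeriv_aux]
  simp only [div_mul_eq_mul_div]
  rw [mul_assoc ((-1 : ℝ) ^ n), sum_hcoef n (fun r => (-1 : ℝ) ^ r * (2 * x) ^ (n - 2 * r) *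
    hermite2 (n - r) (γ + 2 * β * x ^ 2) (-β)), Finset.mul_sum, Finset.sum_mul]
  refine Finset.sum_congr rfl fun r hr => ?_
  rw [Finset.mem_range] at hr
  have hsign : (-1 : ℝ) ^ (n - r) = (-1) ^ n * (-1) ^ r := by
    obtain ⟨k, rfl⟩ := Nat.exists_eq_add_of_le (show r ≤ n by omega)
    rw [Nat.add_sub_cancel_left, pow_add, mul_right_comm, ← pow_add, Even.neg_one_pow ⟨r, rfl⟩,
      one_mul]
  unfold gder
  rw [hsign, show (x ^ 2) ^ 2 = x ^ 4 by ring]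
  ring
end

section
/- For all real γ, β, every natural number n, and every real x, the n-th derivative of the function x ↦ e^{-(γx² + βx⁴)} equals H_n^{(4)}(-2γx - 4βx³, -γ - 6βx², -4βx, -β) · e^{-(γx² + βx⁴)}. -/
open Real

/-- Fourth-order (four-variable) Hermite (Kampé de Fériet) polynomials
`H_n^{(4)}(x₁,x₂,x₃,x₄) = n! ∑_{r₁+2r₂+3r₃+4r₄=n} x₁^{r₁} x₂^{r₂} x₃^{r₃} x₄^{r₄}/(r₁! r₂! r₃! r₄!)`. -/
noncomputable def hermite4 (n : ℕ) (x₁ x₂ x₃ x₄ : ℝ) : ℝ :=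
  (n.factorial : ℝ) *
    ∑ r ∈ (Finset.range (n + 1) ×ˢ Finset.range (n + 1) ×ˢ
            Finset.range (n + 1) ×ˢ Finset.range (n + 1)).filter
        (fun r : ℕ × ℕ × ℕ × ℕ => r.1 + 2 * r.2.1 + 3 * r.2.2.1 + 4 * r.2.2.2 = n),
      x₁ ^ r.1 * x₂ ^ r.2.1 * x₃ ^ r.2.2.1 * x₄ ^ r.2.2.2 /
        ((Nat.factorial r.1 : ℝ) * (Nat.factorial r.2.1 : ℝ) *
          (Nat.factorial r.2.2.1 : ℝ) * (Nat.factorial r.2.2.2 : ℝ))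

theorem hasSum_exp_aux (a t : ℝ) (k : ℕ) :
    HasSum (fun r : ℕ => (a * t ^ k) ^ r / (r.factorial : ℝ)) (Real.exp (a * t ^ k)) := by
  rw [Real.exp_eq_exp_ℝ]
  exact NormedSpace.expSeries_div_hasSum_exp (a * t ^ k)

theorem summable_norm_exp_aux (y : ℝ) :
    Summable (fun r : ℕ => ‖y ^ r / (r.factorial : ℝ)‖) :=
  (Real.summable_pow_div_factorial y).norm

theorem hasSum_mul_aux {α β : Type*} {f : α → ℝ} {g : β → ℝ} {a b : ℝ}
    (hf : HasSum f a) (hg : HasSum g b)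
    (hf' : Summable (fun i => ‖f i‖)) (hg' : Summable (fun i => ‖g i‖)) :
    HasSum (fun p : α × β => f p.1 * g p.2) (a * b) ∧
      Summable (fun p : α × β => ‖f p.1 * g p.2‖) :=
  ⟨hf.mul hg (summable_mul_of_summable_norm hf' hg'), hf'.mul_norm hg'⟩

theorem hasSum_hermite4 (a b c d t : ℝ) :
    HasSum (fun n : ℕ => t ^ n * (hermite4 n a b c d / (n.factorial : ℝ)))
      (Real.exp (a * t ^ 1) * (Real.exp (b * t ^ 2) *
        (Real.exp (c * t ^ 3) * Real.exp (d * t ^ 4)))) := by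
  obtain ⟨h1, h1'⟩ := hasSum_mul_aux (hasSum_exp_aux c t 3) (hasSum_exp_aux d t 4)
    (summable_norm_exp_aux _) (summable_norm_exp_aux _)
  obtain ⟨h2, h2'⟩ := hasSum_mul_aux (hasSum_exp_aux b t 2) h1 (summable_norm_exp_aux _) h1'
  obtain ⟨h3, -⟩ := hasSum_mul_aux (hasSum_exp_aux a t 1) h2 (summable_norm_exp_aux _) h2'
  let w : ℕ × ℕ × ℕ × ℕ → ℕ := fun r => r.1 + 2 * r.2.1 + 3 * r.2.2.1 + 4 * r.2.2.2
  rw [← (Equiv.sigmaFiberEquiv w).hasSum_iff] at h3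
  refine h3.sigma fun n => ?_
  let S := (Finset.range (n + 1) ×ˢ Finset.range (n + 1) ×ˢ
            Finset.range (n + 1) ×ˢ Finset.range (n + 1)).filter
        (fun r : ℕ × ℕ × ℕ × ℕ => r.1 + 2 * r.2.1 + 3 * r.2.2.1 + 4 * r.2.2.2 = n)
  have hS : {r | w r = n} = (S : Set (ℕ × ℕ × ℕ × ℕ)) := by
    ext r
    simp only [w, S, Set.mem_ofPred_eq, Finset.coe_filter, Finset.mem_product, Finset.mem_range]
    omega
  let F : ℕ × ℕ × ℕ × ℕ → ℝ := fun p =>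
    (a * t ^ 1) ^ p.1 / (p.1.factorial : ℝ) * ((b * t ^ 2) ^ p.2.1 / (p.2.1.factorial : ℝ) *
      ((c * t ^ 3) ^ p.2.2.1 / (p.2.2.1.factorial : ℝ) *
        ((d * t ^ 4) ^ p.2.2.2 / (p.2.2.2.factorial : ℝ))))
  change HasSum (F ∘ ((↑) : {r | w r = n} → ℕ × ℕ × ℕ × ℕ)) _
  rw [hS]
  have key : t ^ n * (hermite4 n a b c d / (n.factorial : ℝ)) = ∑ r ∈ S, F r := by
    have hn : (n.factorial : ℝ) ≠ 0 := by positivity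
    rw [hermite4, mul_div_cancel_left₀ _ hn, Finset.mul_sum]
    refine Finset.sum_congr rfl fun r hr => ?_
    have hw := (Finset.mem_filter.1 hr).2
    simp only [F]
    rw [← hw]
    field_simp
    ring
  rw [key]
  exact S.hasSum F

theorem iteratedDeriv_exp_quartic_via_hermite4 (γ β : ℝ) (n : ℕ) (x : ℝ) :
    iteratedDeriv n (fun x : ℝ => Real.exp (-(γ * x ^ 2 + β * x ^ 4))) x
      = hermite4 n (-2 * γ * x - 4 * β * x ^ 3) (-γ - 6 * β * x ^ 2) (-4 * β * x) (-β) *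
          Real.exp (-(γ * x ^ 2 + β * x ^ 4)) := by
  set c : ℕ → ℝ := fun n =>
    hermite4 n (-2 * γ * x - 4 * β * x ^ 3) (-γ - 6 * β * x ^ 2) (-4 * β * x) (-β) /
      (n.factorial : ℝ) * Real.exp (-(γ * x ^ 2 + β * x ^ 4)) with hc
  have hp : HasFPowerSeriesAt (fun x : ℝ => Real.exp (-(γ * x ^ 2 + β * x ^ 4)))
      (FormalMultilinearSeries.ofScalars ℝ c) x := by
    rw [hasFPowerSeriesAt_iff]
    refine Filter.Eventually.of_forall fun t => ?_
    have h := (hasSum_hermite4 (-2 * γ * x - 4 * β * x ^ 3) (-γ - 6 * β * x ^ 2)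
      (-4 * β * x) (-β) t).mul_right (Real.exp (-(γ * x ^ 2 + β * x ^ 4)))
    convert h using 1
    · rfl
    · funext k
      simp only [FormalMultilinearSeries.coeff_ofScalars, smul_eq_mul, hc]
      ring
    · simp only [← Real.exp_add]
      congr 1
      ring
  have hq := hp.analyticAt.hasFPowerSeriesAt
  have h := congrArg (fun p => FormalMultilinearSeries.coeff p n)
    (hq.eq_formalMultilinearSeries hp)
  simp only [FormalMultilinearSeries.coeff_ofScalars, hc] at h
  have hn : (n.factorial : ℝ) ≠ 0 := by positivity
  rwa [div_mul_eq_mul_div, div_left_inj' hn] at h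
end

section
/- For all real β > 0 and γ ≥ 0, the two convergent integrals satisfy ∫_{-∞}^{∞} e^{-(γx² + βx⁴)} dx = β^{-1/4} · e^{γ²/(4β)} · ∫_0^∞ e^{-t²/4} · t^{-1/2} · cos(γt/(2√β) + π/4) dt. -/
open Real MeasureTheory

open Filter Topology in
lemma qg_integrable_abs {f : ℝ → ℝ} (h : IntegrableOn f (Set.Ioi 0)) :
    Integrable (fun x => f |x|) := by
  have hf : IntegrableOn (fun x => f |x|) (Set.Ioi 0) := by
    refine h.congr_fun (fun x hx => ?_) measurableSet_Ioi
    rw [abs_of_pos hx]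
  have int_Iic : IntegrableOn (fun x ↦ f |x|) (Set.Iic 0) := by
    rw [← Measure.map_neg_eq_self (volume : Measure ℝ)]
    let m : MeasurableEmbedding fun x : ℝ => -x := (Homeomorph.neg ℝ).measurableEmbedding
    rw [m.integrableOn_map_iff]
    simp_rw [Function.comp_def, abs_neg, Set.neg_preimage, Set.neg_Iic, neg_zero]
    exact Iff.mpr integrableOn_Ici_iff_integrableOn_Ioi hf
  have := int_Iic.union hf
  rwa [Set.Iic_union_Ioi, integrableOn_univ] at this

lemma qg_integrable_left (c : ℝ) (hc : 0 ≤ c) :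
    Integrable (fun x : ℝ => Real.exp (-(x ^ 2 + c / 2) ^ 2)) := by
  refine ((integrable_exp_neg_mul_sq (b := 1) one_pos).const_mul (Real.exp (1 / 4))).mono'
    (by fun_prop) (ae_of_all _ fun x => ?_)
  rw [Real.norm_eq_abs, abs_of_pos (Real.exp_pos _), ← Real.exp_add]
  apply Real.exp_le_exp.mpr
  nlinarith [sq_nonneg (x ^ 2 - 1 / 2), mul_nonneg hc (sq_nonneg x), sq_nonneg c]

lemma qg_integrable_base :
    IntegrableOn (fun t : ℝ => Real.exp (-t ^ 2 / 4) * t ^ (-(1 : ℝ) / 2)) (Set.Ioi 0) := by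
  refine (integrableOn_rpow_mul_exp_neg_mul_sq (b := 1 / 4) (by norm_num)
    (s := -(1 : ℝ) / 2) (by norm_num)).congr_fun (fun t _ => ?_) measurableSet_Ioi
  simp only
  rw [mul_comm]
  congr 2
  ring

lemma qg_integrable_right (c : ℝ) :
    IntegrableOn (fun t : ℝ => Real.exp (-t ^ 2 / 4) * t ^ (-(1 : ℝ) / 2) *
      Real.cos (c * t / 2 + π / 4)) (Set.Ioi 0) := by
  refine Integrable.mono' qg_integrable_base ?_ ?_
  · exact (by fun_prop : Measurable _).aestronglyMeasurable
  · filter_upwards [self_mem_ae_restrict measurableSet_Ioi] with t ht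
    have ht : 0 < t := ht
    have h0 : 0 ≤ Real.exp (-t ^ 2 / 4) * t ^ (-(1 : ℝ) / 2) := by positivity
    rw [norm_mul, Real.norm_of_nonneg h0]
    exact mul_le_of_le_one_right h0 (Real.abs_cos_le_one _)

/-- Swapping the integrals in the regularised identity. -/
lemma qg_swap (c ε : ℝ) (hε : 0 < ε) :
    ∫ x : ℝ, Complex.exp (-ε * x ^ 2) *
      (((π : ℂ) / (1 / 4)) ^ (1 / 2 : ℂ) * Complex.exp (-(x ^ 2 + c / 2) ^ 2)) =
    ∫ t : ℝ, Complex.exp (Complex.I * t * (c / 2)) * Complex.exp (-(1 / 4) * t ^ 2) *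
      ((π : ℂ) / (ε - Complex.I * t)) ^ (1 / 2 : ℂ) := by
  have key : ∫ x : ℝ, ∫ t : ℝ, Complex.exp (-ε * x ^ 2) *
        (Complex.exp (Complex.I * (x ^ 2 + c / 2) * t) * Complex.exp (-(1 / 4) * t ^ 2)) =
      ∫ t : ℝ, ∫ x : ℝ, Complex.exp (-ε * x ^ 2) *
        (Complex.exp (Complex.I * (x ^ 2 + c / 2) * t) * Complex.exp (-(1 / 4) * t ^ 2)) := by
    apply integral_integral_swap
    have h1 := integrable_exp_neg_mul_sq hε
    have h2 := integrable_exp_neg_mul_sq (b := 1 / 4) (by norm_num)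
    refine (h1.mul_prod h2).mono' ?_ (ae_of_all _ fun z => ?_)
    · apply Continuous.aestronglyMeasurable
      unfold Function.uncurry
      fun_prop
    · obtain ⟨x, t⟩ := z
      simp only [Function.uncurry]
      rw [norm_mul, norm_mul, Complex.norm_exp, Complex.norm_exp, Complex.norm_exp]
      have e1 : (-(ε : ℂ) * x ^ 2).re = -ε * x ^ 2 := by
        norm_cast
      have e2 : (Complex.I * ((x : ℂ) ^ 2 + c / 2) * t).re = 0 := by
        have : Complex.I * ((x : ℂ) ^ 2 + c / 2) * t = Complex.I * (((x ^ 2 + c / 2) * t : ℝ) : ℂ) := by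
          push_cast; ring
        rw [this, Complex.re_mul_ofReal]; simp
      have e3 : (-(1 / 4 : ℂ) * t ^ 2).re = -(1 / 4) * t ^ 2 := by
        have : (-(1 / 4 : ℂ) * t ^ 2) = ((-(1 / 4) * t ^ 2 : ℝ) : ℂ) := by push_cast; ring
        rw [this, Complex.ofReal_re]
      rw [e1, e2, e3, Real.exp_zero, one_mul]
  convert key using 1
  · congr 1
    ext x
    rw [integral_const_mul]
    rw [fourierIntegral_gaussian (b := 1 / 4) (by norm_num)]
    congr 3
    ring
  · congr 1
    ext t
    have := integral_gaussian_complex (b := (ε : ℂ) - Complex.I * t) (by simpa using hε)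
    rw [← this, ← integral_const_mul]
    congr 1
    ext x
    rw [← Complex.exp_add, ← Complex.exp_add, ← Complex.exp_add, ← Complex.exp_add]
    congr 1
    ring

lemma qg_re_limit (c t : ℝ) (ht : t ≠ 0) :
    (Complex.exp (Complex.I * t * (c / 2)) * Complex.exp (-(1 / 4) * t ^ 2) *
      ((π : ℂ) / (((0 : ℝ) : ℂ) - Complex.I * t)) ^ (1 / 2 : ℂ)).re =
    √π * (Real.exp (-|t| ^ 2 / 4) * |t| ^ (-(1 : ℝ) / 2) * Real.cos (c * |t| / 2 + π / 4)) := by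
  have hpos : 0 < |t| := abs_pos.mpr ht
  have hr : 0 < π / |t| := by positivity
  have hconst : Real.exp (Real.log (π / |t|) / 2) = √π * |t| ^ (-(1 : ℝ) / 2) := by
    rw [Real.log_div pi_pos.ne' hpos.ne', Real.sqrt_eq_rpow, Real.rpow_def_of_pos pi_pos,
      Real.rpow_def_of_pos hpos, ← Real.exp_add]
    congr 1
    ring
  have main : ∀ s : ℝ, (Complex.exp (Complex.I * t * (c / 2)) * Complex.exp (-(1 / 4) * t ^ 2) *
      Complex.exp ((Real.log (π / |t|) + s * Complex.I) * (1 / 2))).re =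
      √π * (Real.exp (-|t| ^ 2 / 4) * |t| ^ (-(1 : ℝ) / 2) * Real.cos (c * t / 2 + s / 2)) := by
    intro s
    have : Complex.exp (Complex.I * t * (c / 2)) * Complex.exp (-(1 / 4) * t ^ 2) *
      Complex.exp ((Real.log (π / |t|) + s * Complex.I) * (1 / 2)) =
      ((Real.exp (-|t| ^ 2 / 4) * Real.exp (Real.log (π / |t|) / 2) : ℝ) : ℂ) *
        Complex.exp (((c * t / 2 + s / 2 : ℝ) : ℂ) * Complex.I) := by
      rw [sq_abs]
      push_cast
      rw [← Complex.exp_add, ← Complex.exp_add, ← Complex.exp_add, ← Complex.exp_add]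
      congr 1
      ring
    rw [this, Complex.re_ofReal_mul, Complex.exp_ofReal_mul_I_re, hconst]
    ring
  rcases lt_or_gt_of_ne ht with h | h
  · have e : (π : ℂ) / (((0 : ℝ) : ℂ) - Complex.I * t) = ((π / |t| : ℝ) : ℂ) * (-Complex.I) := by
      rw [abs_of_neg h]
      have : (t : ℂ) ≠ 0 := by exact_mod_cast ht
      push_cast
      rw [zero_sub, div_eq_iff (by simp [this])]
      field_simp
      simp
    have e2 : Complex.log (-Complex.I) = ((-(π / 2) : ℝ) : ℂ) * Complex.I := by
      rw [Complex.log_neg_I]; push_cast; ring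
    rw [e, Complex.cpow_def_of_ne_zero (by simp [ht]),
      Complex.log_ofReal_mul hr (by simp), e2, main]
    rw [abs_of_neg h, ← Real.cos_neg]
    congr 3
    ring
  · have e : (π : ℂ) / (((0 : ℝ) : ℂ) - Complex.I * t) = ((π / |t| : ℝ) : ℂ) * (Complex.I) := by
      rw [abs_of_pos h]
      have : (t : ℂ) ≠ 0 := by exact_mod_cast ht
      push_cast
      rw [zero_sub, div_eq_iff (by simp [this])]
      field_simp
      simp
    have e2 : Complex.log (Complex.I) = (((π / 2) : ℝ) : ℂ) * Complex.I := by
      rw [Complex.log_I]; push_cast; ring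
    rw [e, Complex.cpow_def_of_ne_zero (by simp [ht]),
      Complex.log_ofReal_mul hr (by simp), e2, main]
    rw [abs_of_pos h]
    congr 3
    ring

lemma qg_bound (c t ε : ℝ) (ht : t ≠ 0) :
    ‖Complex.exp (Complex.I * t * (c / 2)) * Complex.exp (-(1 / 4) * t ^ 2) *
      ((π : ℂ) / ((ε : ℂ) - Complex.I * t)) ^ (1 / 2 : ℂ)‖ ≤
    √π * (Real.exp (-|t| ^ 2 / 4) * |t| ^ (-(1 : ℝ) / 2)) := by
  have hpos : 0 < |t| := abs_pos.mpr ht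
  have e1 : (Complex.I * t * (c / 2)).re = 0 := by
    have : Complex.I * t * (c / 2) = Complex.I * ((t * (c / 2) : ℝ) : ℂ) := by push_cast; ring
    rw [this, Complex.re_mul_ofReal]; simp
  have e3 : (-(1 / 4 : ℂ) * t ^ 2).re = -|t| ^ 2 / 4 := by
    have : (-(1 / 4 : ℂ) * t ^ 2) = ((-t ^ 2 / 4 : ℝ) : ℂ) := by push_cast; ring
    rw [this, Complex.ofReal_re, sq_abs]
  have e4 : ‖((π : ℂ) / ((ε : ℂ) - Complex.I * t)) ^ (1 / 2 : ℂ)‖ ≤ √π * |t| ^ (-(1 : ℝ) / 2) := by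
    have h12 : (1 / 2 : ℂ) = ((1 / 2 : ℝ) : ℂ) := by push_cast; rfl
    have hre : ((ε : ℂ) - Complex.I * t).re = ε := by simp
    have him : ((ε : ℂ) - Complex.I * t).im = -t := by simp
    have hne : (ε : ℂ) - Complex.I * t ≠ 0 := by
      intro h; rw [h] at him; simp at him; exact ht him
    have hle : |t| ≤ ‖(ε : ℂ) - Complex.I * t‖ := by
      have := Complex.abs_im_le_norm ((ε : ℂ) - Complex.I * t)
      rwa [him, abs_neg] at this
    rw [h12, Complex.norm_cpow_real, norm_div, Complex.norm_real, Real.norm_of_nonneg pi_pos.le]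
    calc (π / ‖(ε : ℂ) - Complex.I * t‖) ^ (1 / 2 : ℝ) ≤ (π / |t|) ^ (1 / 2 : ℝ) := by
          gcongr
      _ = √π * |t| ^ (-(1 : ℝ) / 2) := by
          rw [Real.div_rpow pi_pos.le hpos.le, Real.sqrt_eq_rpow, neg_div, Real.rpow_neg hpos.le]
          rfl
  rw [norm_mul, norm_mul, Complex.norm_exp, Complex.norm_exp, e1, e3, Real.exp_zero, one_mul]
  calc _ ≤ Real.exp (-|t| ^ 2 / 4) * (√π * |t| ^ (-(1 : ℝ) / 2)) := by gcongr
    _ = _ := by ring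

open Filter Topology in
lemma qg_core (c : ℝ) (hc : 0 ≤ c) :
    ∫ x : ℝ, Real.exp (-(x ^ 2 + c / 2) ^ 2) =
    ∫ t in Set.Ioi (0 : ℝ), Real.exp (-t ^ 2 / 4) * t ^ (-(1 : ℝ) / 2) *
      Real.cos (c * t / 2 + π / 4) := by
  have hk : ((π : ℂ) / (1 / 4)) ^ (1 / 2 : ℂ) = ((2 * √π : ℝ) : ℂ) := by
    have h1 : (π : ℂ) / (1 / 4) = ((4 * π : ℝ) : ℂ) := by push_cast; ring
    have h12 : (1 / 2 : ℂ) = ((1 / 2 : ℝ) : ℂ) := by push_cast; rfl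
    rw [h1, h12, ← Complex.ofReal_cpow (by positivity), ← Real.sqrt_eq_rpow,
      Real.sqrt_mul (by norm_num)]
    congr 2
    rw [show (4 : ℝ) = 2 ^ 2 by norm_num]
    exact Real.sqrt_sq (by norm_num)
  have L1 : Tendsto (fun ε : ℝ => ∫ x : ℝ, Complex.exp (-ε * x ^ 2) *
      (((π : ℂ) / (1 / 4)) ^ (1 / 2 : ℂ) * Complex.exp (-(x ^ 2 + c / 2) ^ 2))) (𝓝[>] 0)
      (𝓝 (∫ x : ℝ, Complex.exp (-(0 : ℝ) * x ^ 2) *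
      (((π : ℂ) / (1 / 4)) ^ (1 / 2 : ℂ) * Complex.exp (-(x ^ 2 + c / 2) ^ 2)))) := by
    apply tendsto_integral_filter_of_dominated_convergence
      (fun x : ℝ => 2 * √π * Real.exp (-(x ^ 2 + c / 2) ^ 2))
    · refine Eventually.of_forall fun ε => ?_
      apply Continuous.aestronglyMeasurable
      fun_prop
    · filter_upwards [self_mem_nhdsWithin] with ε hε
      refine ae_of_all _ fun x => ?_
      have hε : 0 < ε := hε
      have e1 : (-(ε : ℂ) * x ^ 2).re = -ε * x ^ 2 := by norm_cast
      have e2 : (-((x : ℂ) ^ 2 + c / 2) ^ 2).re = -(x ^ 2 + c / 2) ^ 2 := by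
        have : (-((x : ℂ) ^ 2 + c / 2) ^ 2) = ((-(x ^ 2 + c / 2) ^ 2 : ℝ) : ℂ) := by push_cast; ring
        rw [this, Complex.ofReal_re]
      rw [hk, norm_mul, norm_mul, Complex.norm_exp, Complex.norm_exp, Complex.norm_real,
        Real.norm_of_nonneg (by positivity), e1, e2]
      refine mul_le_of_le_one_left (by positivity) ?_
      apply Real.exp_le_one_iff.mpr
      nlinarith [mul_nonneg hε.le (sq_nonneg x)]
    · exact (qg_integrable_left c hc).const_mul _
    · refine ae_of_all _ fun x => ?_
      refine Tendsto.mono_left (Continuous.tendsto ?_ 0) nhdsWithin_le_nhds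
      fun_prop
  have L2 : Tendsto (fun ε : ℝ => ∫ t : ℝ, Complex.exp (Complex.I * t * (c / 2)) *
      Complex.exp (-(1 / 4) * t ^ 2) * ((π : ℂ) / (ε - Complex.I * t)) ^ (1 / 2 : ℂ)) (𝓝[>] 0)
      (𝓝 (∫ t : ℝ, Complex.exp (Complex.I * t * (c / 2)) *
      Complex.exp (-(1 / 4) * t ^ 2) *
        ((π : ℂ) / (((0 : ℝ) : ℂ) - Complex.I * t)) ^ (1 / 2 : ℂ))) := by
    apply tendsto_integral_filter_of_dominated_convergence
      (fun t : ℝ => √π * (Real.exp (-|t| ^ 2 / 4) * |t| ^ (-(1 : ℝ) / 2)))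
    · refine Eventually.of_forall fun ε => ?_
      exact (by fun_prop : Measurable _).aestronglyMeasurable
    · filter_upwards [self_mem_nhdsWithin] with ε hε
      filter_upwards [Measure.ae_ne volume (0 : ℝ)] with t ht
      exact qg_bound c t ε ht
    · exact (qg_integrable_abs qg_integrable_base).const_mul _
    · filter_upwards [Measure.ae_ne volume (0 : ℝ)] with t ht
      refine Tendsto.mono_left (ContinuousAt.tendsto (x := (0 : ℝ)) ?_) nhdsWithin_le_nhds
      have htc : (t : ℂ) ≠ 0 := by exact_mod_cast ht
      have hd : ((0 : ℝ) : ℂ) - Complex.I * t ≠ 0 := by simp [htc]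
      refine continuousAt_const.mul ?_
      refine ContinuousAt.cpow ?_ continuousAt_const ?_
      · exact continuousAt_const.div (by fun_prop) hd
      · right
        have : (π : ℂ) / (((0 : ℝ) : ℂ) - Complex.I * t) = ((π / t : ℝ) : ℂ) * Complex.I := by
          push_cast
          rw [zero_sub, div_eq_iff (by simp [htc])]
          field_simp
          simp
        rw [this, Complex.im_ofReal_mul]
        simp [ht, pi_pos.ne']
  have E := tendsto_nhds_unique_of_eventuallyEq L1 L2 (by
    filter_upwards [self_mem_nhdsWithin] with ε hε
    exact qg_swap c ε hε)
  have Lre : ∫ x : ℝ, Complex.exp (-(0 : ℝ) * x ^ 2) *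
      (((π : ℂ) / (1 / 4)) ^ (1 / 2 : ℂ) * Complex.exp (-(x ^ 2 + c / 2) ^ 2)) =
      ((2 * √π * ∫ x : ℝ, Real.exp (-(x ^ 2 + c / 2) ^ 2) : ℝ) : ℂ) := by
    rw [← integral_const_mul, ← integral_complex_ofReal]
    congr 1
    ext x
    rw [hk]
    push_cast
    simp
  have hI : Integrable (fun t : ℝ => Complex.exp (Complex.I * t * (c / 2)) *
      Complex.exp (-(1 / 4) * t ^ 2) *
        ((π : ℂ) / (((0 : ℝ) : ℂ) - Complex.I * t)) ^ (1 / 2 : ℂ)) := by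
    refine ((qg_integrable_abs qg_integrable_base).const_mul (√π)).mono' ?_ ?_
    · exact (by fun_prop : Measurable _).aestronglyMeasurable
    · filter_upwards [Measure.ae_ne volume (0 : ℝ)] with t ht
      exact qg_bound c t 0 ht
  have E2 := congrArg Complex.re E
  rw [Lre, Complex.ofReal_re] at E2
  have R : (∫ t : ℝ, Complex.exp (Complex.I * t * (c / 2)) * Complex.exp (-(1 / 4) * t ^ 2) *
        ((π : ℂ) / (((0 : ℝ) : ℂ) - Complex.I * t)) ^ (1 / 2 : ℂ)).re =
      ∫ t : ℝ, √π * (fun t => (Real.exp (-t ^ 2 / 4) * t ^ (-(1 : ℝ) / 2) *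
        Real.cos (c * t / 2 + π / 4))) |t| := by
    have h := integral_re hI
    simp only [RCLike.re_eq_complex_re] at h
    rw [← h]
    apply integral_congr_ae
    filter_upwards [Measure.ae_ne volume (0 : ℝ)] with t ht
    exact qg_re_limit c t ht
  rw [R, integral_const_mul, integral_comp_abs (f := fun t => (Real.exp (-t ^ 2 / 4) *
    t ^ (-(1 : ℝ) / 2) * Real.cos (c * t / 2 + π / 4)))] at E2
  have : 0 < √π := by positivity
  have h2 : (2 * √π) * (∫ x : ℝ, Real.exp (-(x ^ 2 + c / 2) ^ 2)) =
    (2 * √π) * ∫ t in Set.Ioi (0 : ℝ), Real.exp (-t ^ 2 / 4) * t ^ (-(1 : ℝ) / 2) *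
      Real.cos (c * t / 2 + π / 4) := by rw [E2]; ring
  exact mul_left_cancel₀ (by positivity) h2

theorem quartic_gaussian_integral_eq_fractional_hermite (β γ : ℝ) (hβ : 0 < β) (hγ : 0 ≤ γ) :
    Integrable (fun x : ℝ => Real.exp (-(γ * x ^ 2 + β * x ^ 4))) ∧
    IntegrableOn (fun t : ℝ => Real.exp (-t ^ 2 / 4) * t ^ (-(1 : ℝ) / 2) *
        Real.cos (γ * t / (2 * Real.sqrt β) + π / 4)) (Set.Ioi 0) ∧
    (∫ x : ℝ, Real.exp (-(γ * x ^ 2 + β * x ^ 4)))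
      = β ^ (-(1 : ℝ) / 4) * Real.exp (γ ^ 2 / (4 * β)) *
          ∫ t in Set.Ioi (0 : ℝ), Real.exp (-t ^ 2 / 4) * t ^ (-(1 : ℝ) / 2) *
            Real.cos (γ * t / (2 * Real.sqrt β) + π / 4) := by
  have hsq : 0 < √β := Real.sqrt_pos.mpr hβ
  have hc : 0 ≤ γ / √β := by positivity
  set c := γ / √β with hcdef
  set s := β ^ ((1 : ℝ) / 4) with hs
  have hspos : 0 < s := by positivity
  have hs2 : s ^ 2 = √β := by
    rw [hs, ← Real.rpow_natCast, ← Real.rpow_mul hβ.le, Real.sqrt_eq_rpow]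
    norm_num
  have hb2 : √β ^ 2 = β := Real.sq_sqrt hβ.le
  have hcs : c * √β = γ := by rw [hcdef]; field_simp
  have hcos : ∀ t : ℝ, γ * t / (2 * √β) = c * t / 2 := by
    intro t; rw [hcdef]; field_simp
  have hfun : (fun x : ℝ => Real.exp (-(γ * x ^ 2 + β * x ^ 4))) =
      fun x => Real.exp (γ ^ 2 / (4 * β)) *
        (fun y => Real.exp (-(y ^ 2 + c / 2) ^ 2)) (s * x) := by
    ext x
    simp only
    rw [← Real.exp_add]
    congr 1
    have h3 : γ ^ 2 / (4 * β) = c ^ 2 / 4 := by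
      rw [hcdef, div_pow, hb2]; field_simp
    rw [h3, mul_pow, hs2]
    have h4 : β * x ^ 4 = √β ^ 2 * x ^ 4 := by rw [hb2]
    rw [h4, ← hcs]
    ring
  refine ⟨?_, ?_, ?_⟩
  · rw [hfun]
    exact ((qg_integrable_left c hc).comp_mul_left' hspos.ne').const_mul _
  · simp_rw [hcos]
    exact qg_integrable_right c
  · simp_rw [hcos]
    rw [hfun, integral_const_mul, Measure.integral_comp_mul_left
      (fun y => Real.exp (-(y ^ 2 + c / 2) ^ 2)), qg_core c hc,
      abs_of_pos (by positivity), smul_eq_mul]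
    have : s⁻¹ = β ^ (-(1 : ℝ) / 4) := by
      rw [hs, neg_div, Real.rpow_neg hβ.le]
    rw [this]
    ring
end

section
/- For every integer n ≥ 2 and all real β > 0 and γ ≥ 0, the two convergent integrals satisfy ∫_0^∞ e^{-(β x^{2n} + γ x^n)} dx = (Γ(1/n)/(n√π)) · β^{-1/(2n)} · e^{γ²/(4β)} · ∫_0^∞ e^{-t²/4} · t^{-1/n} · cos(γt/(2√β) + π/(2n)) dt. -/
open Real MeasureTheory

lemma aux_int {s r : ℝ} (hs : -1 < s) (hr : 0 < r) :
    IntegrableOn (fun t : ℝ => t ^ s * Real.exp (-(r * t))) (Set.Ioi 0) := by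
  have := integrableOn_rpow_mul_exp_neg_mul_rpow hs one_pos hr
  simpa [neg_mul] using this

lemma aux_meas (s : ℝ) (z : ℂ) : AEStronglyMeasurable
    (fun t : ℝ => ((t ^ s : ℝ) : ℂ) * Complex.exp (-(z * t))) (volume.restrict (Set.Ioi 0)) := by
  apply Measurable.aestronglyMeasurable
  fun_prop

lemma aux_norm {s t : ℝ} (z : ℂ) (ht : 0 < t) :
    ‖((t ^ s : ℝ) : ℂ) * Complex.exp (-(z * t))‖ = t ^ s * Real.exp (-(z.re * t)) := by
  rw [norm_mul, Complex.norm_real, Complex.norm_exp, Real.norm_of_nonneg (by positivity)]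
  simp

lemma aux_int_c {s : ℝ} {z : ℂ} (hs : -1 < s) (hz : 0 < z.re) :
    IntegrableOn (fun t : ℝ => ((t ^ s : ℝ) : ℂ) * Complex.exp (-(z * t))) (Set.Ioi 0) := by
  refine (aux_int hs hz).mono' (aux_meas s z) ?_
  filter_upwards [ae_restrict_mem measurableSet_Ioi] with t ht
  exact (aux_norm z ht).le

lemma aux_deriv {a : ℝ} (ha : 0 < a) {z : ℂ} (hz : 0 < z.re) :
    DifferentiableAt ℂ (fun z : ℂ => ∫ t in Set.Ioi (0:ℝ),
      ((t ^ (a - 1) : ℝ) : ℂ) * Complex.exp (-(z * t))) z := by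
  have key := hasDerivAt_integral_of_dominated_loc_of_deriv_le (𝕜 := ℂ)
    (μ := volume.restrict (Set.Ioi (0:ℝ)))
    (F := fun (z : ℂ) (t : ℝ) => ((t ^ (a - 1) : ℝ) : ℂ) * Complex.exp (-(z * t)))
    (F' := fun (z : ℂ) (t : ℝ) => ((t ^ (a - 1) : ℝ) : ℂ) * (Complex.exp (-(z * t)) * (-t)))
    (x₀ := z) (s := Metric.ball z (z.re / 2))
    (bound := fun t : ℝ => t ^ a * Real.exp (-(z.re / 2 * t)))
    (Metric.ball_mem_nhds _ (by positivity))
    (Filter.Eventually.of_forall fun z => aux_meas _ z)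
    (aux_int_c (by linarith) hz)
    (by apply Measurable.aestronglyMeasurable; fun_prop)
    ?_ (aux_int (by linarith) (by positivity)) ?_
  · exact key.2.differentiableAt
  · filter_upwards [ae_restrict_mem measurableSet_Ioi] with t ht w hw
    have ht : 0 < t := ht
    have h1 : z.re / 2 ≤ w.re := by
      have := Complex.abs_re_le_norm (w - z)
      rw [Metric.mem_ball, dist_eq_norm] at hw
      rw [Complex.sub_re] at this
      have := abs_le.1 (this.trans hw.le)
      linarith
    rw [← mul_assoc, norm_mul, aux_norm w ht, norm_neg, Complex.norm_real,
      Real.norm_of_nonneg ht.le]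
    have : t ^ a = t ^ (a - 1) * t := by
      rw [← Real.rpow_add_one ht.ne']; simp
    rw [this]
    have : Real.exp (-(w.re * t)) ≤ Real.exp (-(z.re / 2 * t)) := by
      apply Real.exp_le_exp.2; nlinarith
    have h3 : 0 ≤ t ^ (a - 1) * t := by positivity
    nlinarith
  · filter_upwards with t w hw
    apply HasDerivAt.const_mul
    have : HasDerivAt (fun w : ℂ => -(w * t)) (-(t:ℂ)) w := by
      simpa using! ((hasDerivAt_id w).mul_const (t:ℂ)).neg
    exact this.cexp

lemma aux_gamma {a : ℝ} (ha : 0 < a) {z : ℂ} (hz : 0 < z.re) :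
    ∫ t in Set.Ioi (0:ℝ), ((t ^ (a - 1) : ℝ) : ℂ) * Complex.exp (-(z * t))
      = (1 / z) ^ (a : ℂ) * (Real.Gamma a : ℂ) := by
  have hopen : IsOpen {z : ℂ | 0 < z.re} := isOpen_lt continuous_const Complex.continuous_re
  have hf : AnalyticOnNhd ℂ (fun z : ℂ => ∫ t in Set.Ioi (0:ℝ),
      ((t ^ (a - 1) : ℝ) : ℂ) * Complex.exp (-(z * t))) {z : ℂ | 0 < z.re} :=
    DifferentiableOn.analyticOnNhd
      (fun w hw => (aux_deriv ha hw).differentiableWithinAt) hopen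
  have hg : AnalyticOnNhd ℂ (fun z : ℂ => (1 / z) ^ (a : ℂ) * (Real.Gamma a : ℂ))
      {z : ℂ | 0 < z.re} := by
    refine DifferentiableOn.analyticOnNhd (fun w hw => ?_) hopen
    have hw : 0 < w.re := hw
    have hw0 : w ≠ 0 := by rintro rfl; simp at hw
    apply DifferentiableAt.differentiableWithinAt
    apply DifferentiableAt.mul_const
    apply DifferentiableAt.cpow_const
    · exact (differentiableAt_const _).div differentiableAt_id hw0
    · left
      simp only [one_div, Complex.inv_re]
      have := Complex.normSq_pos.2 hw0
      positivity
  have hpre : IsPreconnected {z : ℂ | 0 < z.re} := (convex_halfSpace_re_gt 0).isPreconnected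
  refine hf.eqOn_of_preconnected_of_frequently_eq hg hpre (z₀ := 1) (by simp) ?_ hz
  have ht : Filter.Tendsto (fun n : ℕ => (((1 + 1 / ((n:ℝ) + 1) : ℝ)) : ℂ)) Filter.atTop
      (nhdsWithin 1 {1}ᶜ) := by
    refine tendsto_nhdsWithin_iff.2 ⟨?_, Filter.Eventually.of_forall fun n => ?_⟩
    · have := (tendsto_one_div_add_atTop_nhds_zero_nat (𝕜 := ℝ)).const_add 1
      rw [add_zero] at this
      simpa [Function.comp_def] using (Complex.continuous_ofReal.tendsto 1).comp this
    · have : (1 + 1 / ((n:ℝ) + 1) : ℝ) ≠ 1 := by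
        have : 0 < 1 / ((n:ℝ) + 1) := by positivity
        linarith
      simp only [Set.mem_compl_iff, Set.mem_singleton_iff]
      exact_mod_cast this
  refine ht.frequently (Filter.Frequently.of_forall fun n => ?_)
  have hr : 0 < (1 + 1 / ((n:ℝ) + 1) : ℝ) := by positivity
  generalize (1 + 1 / ((n:ℝ) + 1) : ℝ) = r at hr
  have := Real.integral_rpow_mul_exp_neg_mul_Ioi ha hr
  have h2 : ((1 : ℂ) / r) ^ (a : ℂ) * (Real.Gamma a : ℂ) = (((1 / r) ^ a * Real.Gamma a : ℝ) : ℂ) := by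
    rw [Complex.ofReal_mul, Complex.ofReal_cpow (by positivity)]; simp
  rw [h2, ← this, ← integral_complex_ofReal]
  simp

lemma aux_gauss (b : ℝ) :
    ∫ t in Set.Ioi (0:ℝ), Real.exp (-t ^ 2 / 4) * Real.cos (b * t) = √π * Real.exp (-b ^ 2) := by
  have h := fourierIntegral_gaussian (b := (1/4 : ℂ)) (by norm_num) b
  have hint : Integrable (fun x : ℝ => Complex.exp (Complex.I * b * x) * Complex.exp (-(1/4) * x ^ 2)) := by
    refine (integrable_cexp_neg_mul_sq (b := (1/4:ℂ)) (by norm_num)).bdd_mul (c := 1)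
      (by apply Continuous.aestronglyMeasurable; fun_prop) (Filter.Eventually.of_forall fun x => ?_)
    rw [Complex.norm_exp]; simp
  have h3 := integral_re (𝕜 := ℂ) hint
  rw [h] at h3
  have h4 := integral_comp_abs (f := fun t : ℝ => Real.exp (-t ^ 2 / 4) * Real.cos (b * t))
  have h5 : ∀ x : ℝ, RCLike.re (Complex.exp (Complex.I * b * x) * Complex.exp (-(1/4) * x ^ 2))
      = Real.exp (-|x| ^ 2 / 4) * Real.cos (b * |x|) := by
    intro x
    have e1 : Real.cos (b * |x|) = Real.cos (b * x) := by
      rcases abs_cases x with h | h <;> rw [h.1]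
      simp
    have e2 : Complex.I * b * x = ((b * x : ℝ) : ℂ) * Complex.I := by push_cast; ring
    have e3 : (-(1/4) * (x:ℂ) ^ 2) = ((-x ^ 2 / 4 : ℝ) : ℂ) := by push_cast; ring
    rw [e1, sq_abs, e2, e3, ← Complex.ofReal_exp]
    simp only [RCLike.re_to_complex, Complex.re_mul_ofReal, Complex.exp_ofReal_mul_I_re]
    ring
  simp_rw [h5] at h3
  rw [h4] at h3
  have e6 : ((π : ℂ) / (1/4)) ^ (1/2 : ℂ) * Complex.exp (-(b:ℂ) ^ 2 / (4 * (1/4)))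
      = ((2 * √π * Real.exp (-b ^ 2) : ℝ) : ℂ) := by
    have : ((π : ℂ) / (1/4)) = ((4 * π : ℝ) : ℂ) := by push_cast; ring
    have h12 : (1/2 : ℂ) = ((1/2 : ℝ) : ℂ) := by push_cast; ring
    rw [this, h12, ← Complex.ofReal_cpow (by positivity), ← Real.sqrt_eq_rpow,
      Real.sqrt_mul (by norm_num), show (4:ℝ) = 2 ^ 2 by norm_num, Real.sqrt_sq (by norm_num)]
    push_cast
    norm_num
  rw [e6] at h3
  simp only [RCLike.re_to_complex, Complex.ofReal_re] at h3
  linarith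

lemma aux_inner {a ε k c t : ℝ} (ha : 0 < a) (hε : 0 < ε) :
    ∫ u in Set.Ioi (0:ℝ), u ^ (a - 1) * Real.exp (-(ε * u)) * Real.cos (k * (u + c) * t)
      = (Complex.exp (((k * c * t : ℝ) : ℂ) * Complex.I) *
          (1 / ((ε : ℂ) - (k * t : ℝ) * Complex.I)) ^ (a : ℂ)).re * Real.Gamma a := by
  have hz : 0 < ((ε : ℂ) - (k * t : ℝ) * Complex.I).re := by simpa using hε
  have h1 := aux_gamma ha hz
  have h2 := (aux_int_c (s := a - 1) (by linarith) hz).const_mul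
    (Complex.exp (((k * c * t : ℝ) : ℂ) * Complex.I))
  have h3 := integral_re (𝕜 := ℂ) h2
  rw [integral_const_mul, h1, ← mul_assoc] at h3
  simp only [RCLike.re_to_complex] at h3
  rw [Complex.re_mul_ofReal] at h3
  rw [← h3]
  refine integral_congr_ae (Filter.Eventually.of_forall fun u => ?_)
  simp only
  have e : Complex.exp (((k * c * t : ℝ) : ℂ) * Complex.I) * (((u ^ (a - 1) : ℝ) : ℂ) *
      Complex.exp (-(((ε : ℂ) - (k * t : ℝ) * Complex.I) * u)))
      = ((u ^ (a - 1) * Real.exp (-(ε * u)) : ℝ) : ℂ) *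
        Complex.exp (((k * (u + c) * t : ℝ) : ℂ) * Complex.I) := by
    rw [mul_left_comm, ← Complex.exp_add, Complex.ofReal_mul (u ^ (a - 1)), Complex.ofReal_exp, mul_assoc (((u ^ (a - 1) : ℝ) : ℂ)),
      ← Complex.exp_add]
    congr 2
    push_cast; ring
  rw [e, Complex.re_ofReal_mul, Complex.exp_ofReal_mul_I_re]

lemma aux_gauss_int : IntegrableOn (fun t : ℝ => Real.exp (-t ^ 2 / 4)) (Set.Ioi 0) := by
  have := (integrable_exp_neg_mul_sq (b := 1/4) (by norm_num)).integrableOn (s := Set.Ioi 0)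
  refine this.congr_fun (fun t _ => ?_) measurableSet_Ioi
  simp only; congr 1; ring

lemma aux_swap {a ε k c : ℝ} (ha : 0 < a) (hε : 0 < ε) :
    √π * ∫ u in Set.Ioi (0:ℝ), u ^ (a - 1) * Real.exp (-(ε * u)) * Real.exp (-(k * (u + c)) ^ 2)
      = Real.Gamma a * ∫ t in Set.Ioi (0:ℝ), Real.exp (-t ^ 2 / 4) *
        (Complex.exp (((k * c * t : ℝ) : ℂ) * Complex.I) *
          (1 / ((ε : ℂ) - (k * t : ℝ) * Complex.I)) ^ (a : ℂ)).re := by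
  have hint : Integrable (Function.uncurry fun u t : ℝ => u ^ (a - 1) * Real.exp (-(ε * u)) *
      (Real.exp (-t ^ 2 / 4) * Real.cos (k * (u + c) * t)))
      ((volume.restrict (Set.Ioi 0)).prod (volume.restrict (Set.Ioi 0))) := by
    have h1 := Integrable.mul_prod (aux_int (s := a - 1) (by linarith) hε) aux_gauss_int
    refine h1.mono ?_ (Filter.Eventually.of_forall ?_)
    · apply Measurable.aestronglyMeasurable
      unfold Function.uncurry
      fun_prop
    · rintro ⟨u, t⟩
      simp only [Function.uncurry, norm_mul]
      rw [← mul_assoc]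
      exact mul_le_of_le_one_right (by positivity) (Real.abs_cos_le_one _)
  have hs := integral_integral_swap hint
  simp_rw [integral_const_mul, aux_gauss] at hs
  rw [← integral_const_mul, ← integral_const_mul]
  calc _ = _ := ?_
    _ = _ := hs
    _ = _ := ?_
  · refine integral_congr_ae (Filter.Eventually.of_forall fun u => ?_)
    simp only; ring
  · refine integral_congr_ae (Filter.Eventually.of_forall fun t => ?_)
    simp only
    have := aux_inner (a := a) (k := k) (c := c) (t := t) ha hε
    calc _ = ∫ u in Set.Ioi (0:ℝ), Real.exp (-t ^ 2 / 4) * (u ^ (a - 1) * Real.exp (-(ε * u)) * Real.cos (k * (u + c) * t)) := by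
            congr 1; ext u; ring
      _ = _ := by rw [integral_const_mul, this]; ring

lemma aux_dom {a : ℝ} (ha1 : a < 1) :
    IntegrableOn (fun t : ℝ => Real.exp (-t ^ 2 / 4) * t ^ (-a)) (Set.Ioi 0) := by
  have := integrableOn_rpow_mul_exp_neg_mul_sq (b := 1/4) (by norm_num) (s := -a) (by linarith)
  refine this.congr_fun (fun t _ => ?_) measurableSet_Ioi
  simp only; rw [mul_comm]; congr 2; ring

lemma aux_cpow {a s : ℝ} (hs : 0 < s) :
    (1 / ((0 : ℂ) - (s : ℝ) * Complex.I)) ^ (a : ℂ)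
      = ((s ^ (-a) : ℝ) : ℂ) * Complex.exp (((π * a / 2 : ℝ) : ℂ) * Complex.I) := by
  have e : (1 / ((0 : ℂ) - (s : ℝ) * Complex.I)) = ((s⁻¹ : ℝ) : ℂ) * Complex.I := by
    have : (s : ℂ) ≠ 0 := by exact_mod_cast hs.ne'
    push_cast
    rw [zero_sub, one_div, inv_neg, mul_inv, Complex.inv_I]; ring
  have hne : ((s⁻¹ : ℝ) : ℂ) * Complex.I ≠ 0 :=
    mul_ne_zero (by exact_mod_cast (inv_pos.2 hs).ne') Complex.I_ne_zero
  rw [e, Complex.cpow_def_of_ne_zero hne, Complex.log_ofReal_mul (inv_pos.2 hs) Complex.I_ne_zero,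
    Complex.log_I, Real.rpow_def_of_pos hs, Complex.ofReal_exp, ← Complex.exp_add, Real.log_inv]
  congr 1
  push_cast; ring

lemma aux_main {a k c : ℝ} (ha : 0 < a) (ha1 : a < 1) (hk : 0 < k) (hc : 0 ≤ c) :
    √π * ∫ u in Set.Ioi (0:ℝ), u ^ (a - 1) * Real.exp (-(k * (u + c)) ^ 2)
      = Real.Gamma a * k ^ (-a) * ∫ t in Set.Ioi (0:ℝ), Real.exp (-t ^ 2 / 4) * t ^ (-a) *
        Real.cos (k * c * t + π * a / 2) := by
  have hL : Filter.Tendsto (fun ε : ℝ => ∫ u in Set.Ioi (0:ℝ),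
      u ^ (a - 1) * Real.exp (-(ε * u)) * Real.exp (-(k * (u + c)) ^ 2)) (nhdsWithin 0 (Set.Ioi 0))
      (nhds (∫ u in Set.Ioi (0:ℝ), u ^ (a - 1) * Real.exp (-(k * (u + c)) ^ 2))) := by
    refine tendsto_integral_filter_of_dominated_convergence
      (fun u => u ^ (a - 1) * Real.exp (- k ^ 2 * u ^ 2)) ?_ ?_
      (integrableOn_rpow_mul_exp_neg_mul_sq (by positivity) (by linarith)) ?_
    · refine Filter.Eventually.of_forall fun ε => ?_
      apply Measurable.aestronglyMeasurable; fun_prop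
    · filter_upwards [self_mem_nhdsWithin] with ε hε
      have hε : 0 < ε := hε
      filter_upwards [ae_restrict_mem measurableSet_Ioi] with u hu
      have hu : 0 < u := hu
      rw [Real.norm_of_nonneg (by positivity), mul_assoc, ← Real.exp_add]
      gcongr
      have : 0 ≤ ε * u := by positivity
      have : 0 ≤ k ^ 2 * (2 * u * c + c ^ 2) := by positivity
      nlinarith
    · refine Filter.Eventually.of_forall fun u => ?_
      have : Continuous (fun ε : ℝ => u ^ (a - 1) * Real.exp (-(ε * u)) * Real.exp (-(k * (u + c)) ^ 2)) := by
        fun_prop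
      simpa using (this.tendsto 0).mono_left nhdsWithin_le_nhds
  have hR : Filter.Tendsto (fun ε : ℝ => ∫ t in Set.Ioi (0:ℝ), Real.exp (-t ^ 2 / 4) *
        (Complex.exp (((k * c * t : ℝ) : ℂ) * Complex.I) *
          (1 / ((ε : ℂ) - (k * t : ℝ) * Complex.I)) ^ (a : ℂ)).re) (nhdsWithin 0 (Set.Ioi 0))
      (nhds (∫ t in Set.Ioi (0:ℝ), Real.exp (-t ^ 2 / 4) *
        (Complex.exp (((k * c * t : ℝ) : ℂ) * Complex.I) *
          (1 / (((0 : ℝ) : ℂ) - (k * t : ℝ) * Complex.I)) ^ (a : ℂ)).re)) := by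
    refine tendsto_integral_filter_of_dominated_convergence
      (fun t => k ^ (-a) * (Real.exp (-t ^ 2 / 4) * t ^ (-a))) ?_ ?_
      ((aux_dom ha1).const_mul _) ?_
    · refine Filter.Eventually.of_forall fun ε => ?_
      apply Measurable.aestronglyMeasurable; fun_prop
    · filter_upwards [self_mem_nhdsWithin] with ε hε
      have hε : 0 < ε := hε
      filter_upwards [ae_restrict_mem measurableSet_Ioi] with t ht
      have ht : 0 < t := ht
      rw [norm_mul, Real.norm_of_nonneg (Real.exp_pos _).le, mul_left_comm]
      refine mul_le_mul_of_nonneg_left ?_ (Real.exp_pos _).le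
      refine (Complex.abs_re_le_norm _).trans ?_
      rw [norm_mul, Complex.norm_exp_ofReal_mul_I, one_mul, Complex.norm_cpow_real,
        ← Real.mul_rpow hk.le ht.le, norm_div, norm_one, one_div, Real.rpow_neg (by positivity),
        ← Real.inv_rpow (by positivity)]
      gcongr
      have := Complex.abs_im_le_norm ((ε : ℂ) - (k * t : ℝ) * Complex.I)
      refine le_trans ?_ this
      simp only [Complex.sub_im, Complex.ofReal_im, Complex.im_ofReal_mul, Complex.I_im]
      rw [zero_sub, abs_neg, mul_one]; exact le_abs_self _
    · filter_upwards [ae_restrict_mem measurableSet_Ioi] with t ht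
      have ht : 0 < t := ht
      have hkt : 0 < k * t := by positivity
      have hne : (((0 : ℝ) : ℂ) - (k * t : ℝ) * Complex.I) ≠ 0 := by
        intro h
        have := congrArg Complex.im h
        simp [-Complex.ofReal_mul] at this
        rcases this with h | h <;> linarith
      have : ContinuousAt (fun ε : ℝ => Real.exp (-t ^ 2 / 4) *
        (Complex.exp (((k * c * t : ℝ) : ℂ) * Complex.I) *
          (1 / ((ε : ℂ) - (k * t : ℝ) * Complex.I)) ^ (a : ℂ)).re) 0 := by
        refine continuousAt_const.mul (Complex.continuous_re.continuousAt.comp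
          (continuousAt_const.mul (ContinuousAt.cpow ?_ continuousAt_const ?_)))
        · refine continuousAt_const.div ?_ hne
          fun_prop
        · right
          have := Complex.normSq_pos.2 hne
          rw [one_div, Complex.inv_im]
          apply div_ne_zero _ this.ne'
          simp [-Complex.ofReal_mul]
          exact ⟨hk.ne', ht.ne'⟩
      exact this.tendsto.mono_left nhdsWithin_le_nhds
  have h1 := hL.const_mul √π
  have h2 := hR.const_mul (Real.Gamma a)
  have h3 := tendsto_nhds_unique (h1.congr' (by
    filter_upwards [self_mem_nhdsWithin] with ε hε
    exact aux_swap ha hε)) h2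
  rw [h3, mul_assoc, ← integral_const_mul (k ^ (-a))]
  congr 1
  refine setIntegral_congr_fun measurableSet_Ioi fun t ht => ?_
  have ht : 0 < t := ht
  rw [Complex.ofReal_zero, aux_cpow (by positivity), mul_left_comm, ← Complex.exp_add, ← add_mul,
    ← Complex.ofReal_add, Complex.re_ofReal_mul, Complex.exp_ofReal_mul_I_re,
    Real.mul_rpow hk.le ht.le]
  ring

theorem integral_exp_neg_power_eq_fractional_hermite (n : ℕ) (hn : 2 ≤ n)
    (β γ : ℝ) (hβ : 0 < β) (hγ : 0 ≤ γ) :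
    IntegrableOn (fun x : ℝ => Real.exp (-(β * x ^ (2 * n) + γ * x ^ n))) (Set.Ioi 0) ∧
    IntegrableOn (fun t : ℝ => Real.exp (-t ^ 2 / 4) * t ^ (-(1 : ℝ) / (n : ℝ)) *
        Real.cos (γ * t / (2 * Real.sqrt β) + π / (2 * (n : ℝ)))) (Set.Ioi 0) ∧
    (∫ x in Set.Ioi (0 : ℝ), Real.exp (-(β * x ^ (2 * n) + γ * x ^ n)))
      = (Real.Gamma (1 / (n : ℝ)) / ((n : ℝ) * Real.sqrt π)) *
          β ^ (-(1 : ℝ) / (2 * (n : ℝ))) * Real.exp (γ ^ 2 / (4 * β)) *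
          ∫ t in Set.Ioi (0 : ℝ), Real.exp (-t ^ 2 / 4) * t ^ (-(1 : ℝ) / (n : ℝ)) *
            Real.cos (γ * t / (2 * Real.sqrt β) + π / (2 * (n : ℝ))) := by
  have hn2 : (2:ℝ) ≤ n := by exact_mod_cast hn
  have hn0 : (n:ℝ) ≠ 0 := by positivity
  obtain ⟨a, ha⟩ : ∃ a : ℝ, a = 1 / (n:ℝ) := ⟨_, rfl⟩
  have ha0 : 0 < a := by rw [ha]; positivity
  have ha1 : a < 1 := by rw [ha, div_lt_one (by positivity)]; linarith
  have hpow : ∀ u : ℝ, 0 < u → (u ^ a) ^ n = u := fun u hu => by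
    rw [← Real.rpow_natCast, ← Real.rpow_mul hu.le, ha, one_div_mul_cancel hn0, Real.rpow_one]
  have hg : ∀ u : ℝ, 0 < u → Real.exp (-(β * (u ^ a) ^ (2 * n) + γ * (u ^ a) ^ n))
      = Real.exp (-(β * u ^ 2 + γ * u)) := fun u hu => by
    rw [mul_comm 2 n, pow_mul, hpow u hu]
  refine ⟨?_, ?_, ?_⟩
  · rw [← integrableOn_Ioi_comp_rpow_iff' _ ha0.ne']
    refine (integrableOn_rpow_mul_exp_neg_mul_sq hβ (s := a - 1) (by linarith)).mono' ?_ ?_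
    · apply Measurable.aestronglyMeasurable; fun_prop
    · filter_upwards [ae_restrict_mem measurableSet_Ioi] with u hu
      have hu : 0 < u := hu
      rw [smul_eq_mul, hg u hu, Real.norm_of_nonneg (by positivity)]
      gcongr
      have : 0 ≤ γ * u := by positivity
      linarith
  · have e : -(1:ℝ) / n = -a := by rw [ha]; ring
    rw [e]
    refine (aux_dom ha1).mono' ?_ ?_
    · apply Measurable.aestronglyMeasurable; fun_prop
    · filter_upwards [ae_restrict_mem measurableSet_Ioi] with u hu
      have hu : 0 < u := hu
      rw [norm_mul, Real.norm_of_nonneg (by positivity)]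
      exact mul_le_of_le_one_right (by positivity) (Real.abs_cos_le_one _)
  · have hk : 0 < √β := Real.sqrt_pos.2 hβ
    have hk2 : √β ^ 2 = β := Real.sq_sqrt hβ.le
    have hm := aux_main (a := a) (k := √β) (c := γ / (2 * β)) ha0 ha1 hk (by positivity)
    have hpi : 0 < √π := Real.sqrt_pos.2 Real.pi_pos
    have e : -(1:ℝ) / n = -a := by rw [ha]; ring
    have e2 : β ^ (-(1:ℝ) / (2 * n)) = √β ^ (-a) := by
      rw [Real.sqrt_eq_rpow, ← Real.rpow_mul hβ.le]; congr 1; rw [ha]; ring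
    have e3 : ∀ t : ℝ, γ * t / (2 * √β) + π / (2 * n) = √β * (γ / (2 * β)) * t + π * a / 2 := by
      intro t
      congr 1
      · nth_rewrite 3 [← hk2]
        field_simp
      · rw [ha]; field_simp
    rw [← integral_comp_rpow_Ioi _ ha0.ne', e, e2, ← ha]
    simp_rw [e3]
    have e4 : ∫ x in Set.Ioi (0:ℝ), (|a| * x ^ (a - 1)) •
        Real.exp (-(β * (x ^ a) ^ (2 * n) + γ * (x ^ a) ^ n))
        = a * Real.exp (γ ^ 2 / (4 * β)) * ∫ u in Set.Ioi (0:ℝ), u ^ (a - 1) *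
          Real.exp (-(√β * (u + γ / (2 * β))) ^ 2) := by
      rw [← integral_const_mul]
      refine setIntegral_congr_fun measurableSet_Ioi fun u hu => ?_
      rw [smul_eq_mul, hg u hu, abs_of_pos ha0]
      have : Real.exp (-(β * u ^ 2 + γ * u)) = Real.exp (γ ^ 2 / (4 * β)) *
          Real.exp (-(√β * (u + γ / (2 * β))) ^ 2) := by
        rw [← Real.exp_add]; congr 1
        rw [mul_pow, hk2]; field_simp; ring
      rw [this]; ring
    rw [e4]
    have e5 : ∫ u in Set.Ioi (0:ℝ), u ^ (a - 1) * Real.exp (-(√β * (u + γ / (2 * β))) ^ 2)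
      = (√π)⁻¹ * (√π * ∫ u in Set.Ioi (0:ℝ), u ^ (a - 1) * Real.exp (-(√β * (u + γ / (2 * β))) ^ 2)) :=
      (inv_mul_cancel_left₀ hpi.ne' _).symm
    rw [e5, hm]
    have : (n:ℝ) = a⁻¹ := by rw [ha]; simp
    rw [this]
    generalize (∫ t in Set.Ioi (0:ℝ), Real.exp (-t ^ 2 / 4) * t ^ (-a) *
        Real.cos (√β * (γ / (2 * β)) * t + π * a / 2)) = J
    field_simp
end

section
/- Let a > 0 and let b, c be real. Then the integral J(a,b,c) = ∫_{-∞}^{∞} e^{-(a x⁴ + b x² + c x)} dx converges and equals √π · Σ_{s=0}^∞ (c²/4)^s / (s! · Γ(s + 1/2)) · (2a)^{-(s + 1/2)/2} · ∫_0^∞ t^{s - 1/2} e^{-(b/√(2a)) t - t²/2} dt, where the series on the right converges absolutely for every real b, c and a > 0. -/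
open Real MeasureTheory

lemma quartic_aux_int (a b c : ℝ) (ha : 0 < a) :
    Integrable (fun x : ℝ => Real.exp (-(a * x ^ 4 + b * x ^ 2 + c * x))) := by
  have h := (integrable_exp_neg_mul_sq (b := 1) one_pos).const_mul
    (Real.exp ((b - 2) ^ 2 / (4 * a) + c ^ 2 / 4))
  refine h.mono' (by fun_prop) (Filter.Eventually.of_forall fun x => ?_)
  rw [Real.norm_eq_abs, abs_of_pos (Real.exp_pos _), ← Real.exp_add]
  apply Real.exp_le_exp.mpr
  have h1 : 0 ≤ a * (x ^ 2 + (b - 2) / (2 * a)) ^ 2 := by positivity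
  have h2 : a * (x ^ 2 + (b - 2) / (2 * a)) ^ 2
      = a * x ^ 4 + (b - 2) * x ^ 2 + (b - 2) ^ 2 / (4 * a) := by
    field_simp
    ring
  nlinarith [sq_nonneg (x + c / 2)]

lemma quartic_aux_fact (s : ℕ) :
    (Nat.factorial s : ℝ) * Real.Gamma ((s : ℝ) + 1 / 2) * 4 ^ s
      = Nat.factorial (2 * s) * √π := by
  induction s with
  | zero => simp [-one_div, Real.Gamma_one_half_eq]
  | succ n ih =>
    have h1 : ((n + 1 : ℕ) : ℝ) + 1 / 2 = ((n : ℝ) + 1 / 2) + 1 := by push_cast; ring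
    rw [h1, Real.Gamma_add_one (by positivity), show 2 * (n + 1) = 2 * n + 1 + 1 by ring,
      Nat.factorial_succ, Nat.factorial_succ, Nat.factorial_succ]
    push_cast
    linear_combination (n + 1) * (n + 1 / 2) * 4 * ih

lemma quartic_aux_moment (a b : ℝ) (ha : 0 < a) (s : ℕ) :
    ∫ x : ℝ, x ^ (2 * s) * Real.exp (-(a * x ^ 4 + b * x ^ 2)) =
      (2 * a) ^ (-((s : ℝ) + 1 / 2) / 2) *
        ∫ t in Set.Ioi (0 : ℝ), t ^ ((s : ℝ) - 1 / 2) *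
            Real.exp (-(b / Real.sqrt (2 * a)) * t - t ^ 2 / 2) := by
  set k := Real.sqrt (2 * a) with hk
  have hk0 : 0 < k := Real.sqrt_pos.mpr (by positivity)
  have hk2 : k ^ 2 = 2 * a := Real.sq_sqrt (by positivity)
  set g : ℝ → ℝ := fun t => t ^ ((s : ℝ) - 1 / 2) * Real.exp (-(b / k) * t - t ^ 2 / 2) with hg
  have e1 := integral_comp_mul_left_Ioi g 0 hk0
  rw [mul_zero, smul_eq_mul] at e1
  have e2 := integral_comp_rpow_Ioi_of_pos (g := fun u => g (k * u)) (p := 2) two_pos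
  have e3 := integral_comp_abs (f := fun x : ℝ => x ^ (2 * s) * Real.exp (-(a * x ^ 4 + b * x ^ 2)))
  have e4 : (fun x : ℝ => |x| ^ (2 * s) * Real.exp (-(a * |x| ^ 4 + b * |x| ^ 2)))
      = fun x : ℝ => x ^ (2 * s) * Real.exp (-(a * x ^ 4 + b * x ^ 2)) := by
    funext x
    rw [show |x| ^ 4 = x ^ 4 from (by decide : Even 4).pow_abs x, sq_abs,
      (even_two_mul s).pow_abs x]
  simp only [e4] at e3
  have hpw : (2 * a) ^ (-((s : ℝ) + 1 / 2) / 2) = k ^ (-((s : ℝ) + 1 / 2)) := by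
    rw [← hk2, ← Real.rpow_natCast, ← Real.rpow_mul hk0.le]
    congr 1
    push_cast
    ring
  have e5 : ∫ t in Set.Ioi (0 : ℝ), g t = k * ∫ x in Set.Ioi (0 : ℝ), g (k * x) := by
    rw [e1]; field_simp
  rw [e3, hpw, e5, ← e2, ← integral_const_mul, ← integral_const_mul, ← integral_const_mul]
  refine setIntegral_congr_fun measurableSet_Ioi fun x hx => ?_
  have hx : 0 < x := hx
  simp only [hg, smul_eq_mul]
  have hx2 : x ^ (2 : ℝ) = x ^ 2 := by norm_cast
  rw [hx2, Real.mul_rpow hk0.le (by positivity)]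
  have hE : -(b / k) * (k * x ^ 2) - (k * x ^ 2) ^ 2 / 2 = -(a * x ^ 4 + b * x ^ 2) := by
    rw [mul_pow, hk2]
    field_simp
    ring
  have h1 : k ^ (-((s : ℝ) + 1 / 2)) * (k * k ^ ((s : ℝ) - 1 / 2)) = 1 := by
    nth_rewrite 2 [← Real.rpow_one k]
    rw [← Real.rpow_add hk0, ← Real.rpow_add hk0, ← Real.rpow_zero k]
    congr 1
    ring
  have h2 : x ^ ((2 : ℝ) - 1) * (x ^ 2) ^ ((s : ℝ) - 1 / 2) = x ^ (2 * s) := by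
    rw [← Real.rpow_natCast x 2, ← Real.rpow_mul hx.le, ← Real.rpow_add hx,
      ← Real.rpow_natCast x (2 * s)]
    congr 1
    push_cast
    ring
  rw [hE, ← h2]
  linear_combination (-2 * (x ^ ((2 : ℝ) - 1) * (x ^ 2) ^ ((s : ℝ) - 1 / 2)) *
    Real.exp (-(a * x ^ 4 + b * x ^ 2))) * h1

theorem quartic_integral_parabolic_cylinder_expansion (a b c : ℝ) (ha : 0 < a) :
    Integrable (fun x : ℝ => Real.exp (-(a * x ^ 4 + b * x ^ 2 + c * x))) ∧
    Summable (fun s : ℕ =>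
      |(c ^ 2 / 4) ^ s / ((Nat.factorial s : ℝ) * Real.Gamma ((s : ℝ) + 1 / 2)) *
          (2 * a) ^ (-((s : ℝ) + 1 / 2) / 2) *
          ∫ t in Set.Ioi (0 : ℝ), t ^ ((s : ℝ) - 1 / 2) *
            Real.exp (-(b / Real.sqrt (2 * a)) * t - t ^ 2 / 2)|) ∧
    (∫ x : ℝ, Real.exp (-(a * x ^ 4 + b * x ^ 2 + c * x)))
      = Real.sqrt π * ∑' s : ℕ,
          (c ^ 2 / 4) ^ s / ((Nat.factorial s : ℝ) * Real.Gamma ((s : ℝ) + 1 / 2)) *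
            (2 * a) ^ (-((s : ℝ) + 1 / 2) / 2) *
            ∫ t in Set.Ioi (0 : ℝ), t ^ ((s : ℝ) - 1 / 2) *
              Real.exp (-(b / Real.sqrt (2 * a)) * t - t ^ 2 / 2) := by
  have hI := quartic_aux_int a b c ha
  have hI' := quartic_aux_int a b (-c) ha
  have hsp : √π ≠ 0 := (Real.sqrt_pos.mpr Real.pi_pos).ne'
  set E : ℝ → ℝ := fun x => Real.exp (-(a * x ^ 4 + b * x ^ 2)) with hE
  set F : ℕ → ℝ → ℝ := fun s x => (c * x) ^ (2 * s) / (Nat.factorial (2 * s)) * E x with hF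
  have hcosh : ∀ x, Real.cosh (c * x) * E x =
      (Real.exp (-(a * x ^ 4 + b * x ^ 2 + c * x)) +
        Real.exp (-(a * x ^ 4 + b * x ^ 2 + -c * x))) / 2 := by
    intro x
    rw [Real.cosh_eq, hE, div_mul_eq_mul_div, add_mul, ← Real.exp_add, ← Real.exp_add, add_comm]
    ring_nf
  have hFs : ∀ x, HasSum (fun s => F s x) (Real.cosh (c * x) * E x) := fun x =>
    (Real.hasSum_cosh (c * x)).mul_right _
  have hF0 : ∀ s x, 0 ≤ F s x := fun s x => by
    have := (even_two_mul s).pow_nonneg (c * x)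
    simp only [hF, hE]
    positivity
  have hcI : Integrable (fun x => Real.cosh (c * x) * E x) := by
    simp only [hcosh]
    exact (hI.add hI').div_const 2
  have hsum : HasSum (fun s => ∫ x, F s x) (∫ x, Real.cosh (c * x) * E x) := by
    refine hasSum_integral_of_dominated_convergence F (fun s => ?_)
      (fun s => Filter.Eventually.of_forall fun x => ?_)
      (Filter.Eventually.of_forall fun x => (hFs x).summable) ?_
      (Filter.Eventually.of_forall hFs)
    · have : Continuous (F s) := by simp only [hF, hE]; fun_prop
      exact this.aestronglyMeasurable
    · rw [Real.norm_eq_abs, abs_of_nonneg (hF0 s x)]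
    · simpa only [(hFs _).tsum_eq] using hcI
  have hJ : ∫ x, Real.cosh (c * x) * E x =
      ∫ x : ℝ, Real.exp (-(a * x ^ 4 + b * x ^ 2 + c * x)) := by
    have hneg : ∫ x : ℝ, Real.exp (-(a * x ^ 4 + b * x ^ 2 + -c * x)) =
        ∫ x : ℝ, Real.exp (-(a * x ^ 4 + b * x ^ 2 + c * x)) := by
      rw [← integral_neg_eq_self]
      congr 1
      funext x
      congr 1
      ring
    simp only [hcosh]
    rw [integral_div, integral_add hI hI', hneg]
    ring
  have hterm : ∀ s : ℕ, (c ^ 2 / 4) ^ s / ((Nat.factorial s : ℝ) * Real.Gamma ((s : ℝ) + 1 / 2)) *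
            (2 * a) ^ (-((s : ℝ) + 1 / 2) / 2) *
            (∫ t in Set.Ioi (0 : ℝ), t ^ ((s : ℝ) - 1 / 2) *
              Real.exp (-(b / Real.sqrt (2 * a)) * t - t ^ 2 / 2)) = (√π)⁻¹ * ∫ x, F s x := by
    intro s
    rw [mul_assoc, ← quartic_aux_moment a b ha s]
    have hG : Real.Gamma ((s : ℝ) + 1 / 2) ≠ 0 := (Real.Gamma_pos_of_pos (by positivity)).ne'
    have h2 : ∀ x, F s x = c ^ (2 * s) / (Nat.factorial (2 * s)) *
        (x ^ (2 * s) * Real.exp (-(a * x ^ 4 + b * x ^ 2))) := by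
      intro x
      simp only [hF, hE]
      rw [mul_pow]; ring
    simp only [h2]
    rw [integral_const_mul, ← mul_assoc]
    congr 1
    have h4 := quartic_aux_fact s
    have hs : (Nat.factorial s : ℝ) ≠ 0 := by positivity
    have hs2 : (Nat.factorial (2 * s) : ℝ) ≠ 0 := by positivity
    rw [div_pow, ← pow_mul, div_div, inv_mul_eq_div, div_div, ← h4, mul_comm]
    congr 1
    ring
  refine ⟨hI, ?_, ?_⟩
  · exact ((hsum.summable.mul_left (√π)⁻¹).congr fun s => (hterm s).symm).abs
  · simp only [hterm]
    rw [tsum_mul_left, hsum.tsum_eq, hJ]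
    field_simp
end

section
/- Let x, y be real, let g_{2n} = (1/4)·Γ((2n+1)/4), and let the sequence a_n(x,y) be defined by a_0(x,y) = 1, a_1(x,y) = y, and a_n(x,y) = (1/n)·(y·a_{n-1}(x,y) + 2x·a_{n-2}(x,y)) for n ≥ 2. Then the Pearcey-type integral ∫_{-∞}^{∞} e^{-(t⁴ + x t²)} e^{i y t} dt converges and equals 2 · Σ_{n=0}^∞ (-1)^n · g_{2n} · a_{2n}(x,y), where the series converges absolutely for all real x, y. -/
open Real MeasureTheory

/-- The coefficient sequence `a₀ = 1`, `a₁ = y`,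
`aₙ = (1/n)(y aₙ₋₁ + 2x aₙ₋₂)` for `n ≥ 2`. -/
noncomputable def aSeq (x y : ℝ) : ℕ → ℝ
  | 0 => 1
  | 1 => y
  | n + 2 => (1 / ((n : ℝ) + 2)) * (y * aSeq x y (n + 1) + 2 * x * aSeq x y n)

theorem aSeq_iter (x y : ℝ) (n : ℕ) :
    iteratedDeriv (n + 2) (fun s : ℂ => Complex.exp (x * s ^ 2 + y * s)) =
      fun s : ℂ => (2 * x * s + y) *
        iteratedDeriv (n + 1) (fun s : ℂ => Complex.exp (x * s ^ 2 + y * s)) s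
        + 2 * x * (n + 1) * iteratedDeriv n (fun s : ℂ => Complex.exp (x * s ^ 2 + y * s)) s := by
  have hc : ContDiff ℂ ⊤ (fun s : ℂ => Complex.exp (x * s ^ 2 + y * s)) := by fun_prop
  have hd : ∀ m s, HasDerivAt
      (iteratedDeriv m (fun s : ℂ => Complex.exp (x * s ^ 2 + y * s)))
      (iteratedDeriv (m + 1) (fun s : ℂ => Complex.exp (x * s ^ 2 + y * s)) s) s := by
    intro m s
    rw [iteratedDeriv_succ]
    exact ((hc.differentiable_iteratedDeriv m (by simp [WithTop.lt_top_iff_ne_top])) s).hasDerivAt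
  have hl : ∀ s : ℂ, HasDerivAt (fun s : ℂ => 2 * (x : ℂ) * s + y) (2 * x) s := by
    intro s
    simpa using ((hasDerivAt_id s).const_mul (2 * (x : ℂ))).add_const (y : ℂ)
  induction n with
  | zero =>
    have h1 : iteratedDeriv 1 (fun s : ℂ => Complex.exp (x * s ^ 2 + y * s)) =
        fun s : ℂ => (2 * x * s + y) * iteratedDeriv 0 (fun s : ℂ => Complex.exp (x * s ^ 2 + y * s)) s := by
      funext s
      rw [iteratedDeriv_one, iteratedDeriv_zero]
      have h := ((((hasDerivAt_id s).pow 2).const_mul (x : ℂ)).add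
        ((hasDerivAt_id s).const_mul (y : ℂ))).cexp
      refine (HasDerivAt.deriv (h.congr_deriv ?_ : HasDerivAt (fun s : ℂ => Complex.exp (x * s ^ 2 + y * s)) _ s))
      simp
      ring
    funext s
    have h := (hl s).mul (hd 0 s)
    have h2 := (hd 1 s).unique (by rw [h1]; exact h)
    rw [h2]
    push_cast
    ring
  | succ n ih =>
    funext s
    have h := ((hl s).mul (hd (n + 1) s)).add ((hd n s).const_mul (2 * (x : ℂ) * (n + 1)))
    have h2 := (hd (n + 2) s).unique (by rw [ih]; exact h)
    rw [h2]
    push_cast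
    ring

theorem aSeq_iter_zero (x y : ℝ) (n : ℕ) :
    iteratedDeriv n (fun s : ℂ => Complex.exp (x * s ^ 2 + y * s)) 0 = n.factorial * aSeq x y n := by
  induction n using Nat.twoStepInduction with
  | zero => simp [aSeq]
  | one =>
    rw [iteratedDeriv_one]
    have h := ((((hasDerivAt_id (0 : ℂ)).pow 2).const_mul (x : ℂ)).add
        ((hasDerivAt_id (0 : ℂ)).const_mul (y : ℂ))).cexp
    refine (HasDerivAt.deriv (h.congr_deriv ?_ : HasDerivAt (fun s : ℂ => Complex.exp (x * s ^ 2 + y * s)) _ 0))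
    simp [aSeq]
  | more n h1 h2 =>
    rw [aSeq_iter]
    simp only [h1, h2, aSeq]
    have : (n : ℂ) + 2 ≠ 0 := by exact_mod_cast (by omega : n + 2 ≠ 0)
    push_cast [Nat.factorial_succ]
    field_simp
    ring

theorem aSeq_hasSum (x y : ℝ) (z : ℂ) :
    HasSum (fun n => (aSeq x y n : ℂ) * z ^ n) (Complex.exp (x * z ^ 2 + y * z)) := by
  have hf : Differentiable ℂ (fun s : ℂ => Complex.exp (x * s ^ 2 + y * s)) := by fun_prop
  have h := Complex.hasSum_taylorSeries_of_entire hf 0 z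
  refine h.congr_fun ?_
  intro n
  rw [aSeq_iter_zero]
  have : (n.factorial : ℂ) ≠ 0 := by exact_mod_cast n.factorial_ne_zero
  simp
  field_simp

theorem aSeq_abs_le (x y : ℝ) (n : ℕ) : |aSeq x y n| ≤ aSeq |x| |y| n := by
  induction n using Nat.twoStepInduction with
  | zero => simp [aSeq]
  | one => simp [aSeq]
  | more n h1 h2 =>
    simp only [aSeq]
    rw [abs_mul, abs_of_nonneg (by positivity : (0 : ℝ) ≤ 1 / ((n : ℝ) + 2))]
    gcongr
    refine (abs_add_le _ _).trans ?_
    rw [abs_mul, abs_mul, abs_mul, abs_two]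
    gcongr

theorem aSeq_hasSum_real (x y t : ℝ) :
    HasSum (fun n => aSeq x y n * t ^ n) (Real.exp (x * t ^ 2 + y * t)) := by
  have h := aSeq_hasSum x y t
  exact_mod_cast h

theorem dom_integrable (x y : ℝ) :
    Integrable (fun t : ℝ => Real.exp (|x| * |t| ^ 2 + |y| * |t|) * Real.exp (-t ^ 4)) := by
  have h := (integrable_exp_neg_mul_sq (b := 1) one_pos).const_mul
    (Real.exp (y ^ 2 + (|x| + 2) ^ 2))
  refine h.mono' (by fun_prop) (Filter.Eventually.of_forall fun t => ?_)
  rw [Real.norm_of_nonneg (by positivity), ← Real.exp_add, ← Real.exp_add]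
  apply Real.exp_le_exp.2
  rw [sq_abs]
  nlinarith [sq_nonneg (|y| - |t|), sq_nonneg (t ^ 2 - (|x| + 2)), sq_abs y, sq_abs t,
    sq_nonneg y, sq_nonneg t, sq_nonneg (t ^ 2), sq_nonneg (|x| + 2)]

theorem moment_even (n : ℕ) :
    ∫ t : ℝ, t ^ (2 * n) * Real.exp (-t ^ 4) = 2 * ((1 / 4) * Real.Gamma ((2 * (n : ℝ) + 1) / 4)) := by
  have h := integral_comp_abs (f := fun t : ℝ => t ^ (2 * n) * Real.exp (-t ^ 4))
  have e : ∀ t : ℝ, |t| ^ (2 * n) * Real.exp (-|t| ^ 4) = t ^ (2 * n) * Real.exp (-t ^ 4) := by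
    intro t
    rw [pow_mul, sq_abs, ← pow_mul, (by norm_num : 4 = 2 * 2), pow_mul |t|, sq_abs, ← pow_mul]
  simp only [e] at h
  rw [h]
  congr 1
  have g := integral_rpow_mul_exp_neg_rpow (p := 4) (q := 2 * (n : ℝ)) (by norm_num)
    (by have : (0 : ℝ) ≤ n := by positivity
        linarith)
  rw [← g]
  refine setIntegral_congr_fun measurableSet_Ioi fun t _ => ?_
  rw [← Real.rpow_natCast, ← Real.rpow_natCast t 4]
  push_cast
  rfl

theorem moment_odd (n : ℕ) (hn : Odd n) :
    ∫ t : ℝ, t ^ n * Real.exp (-t ^ 4) = 0 := by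
  have h := integral_neg_eq_self (fun t : ℝ => t ^ n * Real.exp (-t ^ 4)) volume
  simp only [hn.neg_pow, (by decide : Even 4).neg_pow, neg_mul, integral_neg] at h
  linarith

theorem main_hasSum (x y : ℝ) :
    HasSum (fun n : ℕ => ∫ t : ℝ, (aSeq x y n : ℂ) * (Complex.I * t) ^ n * (Real.exp (-t ^ 4) : ℂ))
    (∫ t : ℝ, Complex.exp (-((t : ℂ) ^ 4 + (x : ℂ) * (t : ℂ) ^ 2)) *
        Complex.exp (Complex.I * (y : ℂ) * (t : ℂ))) := by
  have hs : ∀ t : ℝ, HasSum (fun n => aSeq |x| |y| n * |t| ^ n * Real.exp (-t ^ 4))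
      (Real.exp (|x| * |t| ^ 2 + |y| * |t|) * Real.exp (-t ^ 4)) := fun t =>
    (aSeq_hasSum_real |x| |y| |t|).mul_right _
  refine hasSum_integral_of_dominated_convergence
    (fun n (t : ℝ) => aSeq |x| |y| n * |t| ^ n * Real.exp (-t ^ 4)) ?_ ?_ ?_ ?_ ?_
  · intro n
    exact Continuous.aestronglyMeasurable (by fun_prop)
  · intro n
    refine Filter.Eventually.of_forall fun t => ?_
    simp only [norm_mul, norm_pow, Complex.norm_real, Complex.norm_I, one_mul, Real.norm_eq_abs,
      Real.abs_exp]
    gcongr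
    exact aSeq_abs_le x y n
  · exact Filter.Eventually.of_forall fun t => (hs t).summable
  · refine (dom_integrable x y).congr (Filter.Eventually.of_forall fun t => ?_)
    exact (hs t).tsum_eq.symm
  · refine Filter.Eventually.of_forall fun t => ?_
    have h := (aSeq_hasSum x y (Complex.I * t)).mul_right (Real.exp (-t ^ 4) : ℂ)
    have e : Complex.exp (x * (Complex.I * t) ^ 2 + y * (Complex.I * t)) * (Real.exp (-t ^ 4) : ℂ) =
        Complex.exp (-((t : ℂ) ^ 4 + (x : ℂ) * (t : ℂ) ^ 2)) *
        Complex.exp (Complex.I * (y : ℂ) * (t : ℂ)) := by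
      rw [Complex.ofReal_exp, ← Complex.exp_add, ← Complex.exp_add, mul_pow, Complex.I_sq]
      congr 1
      push_cast
      ring
    rw [e] at h
    exact h

theorem main_term (x y : ℝ) (n : ℕ) :
    ∫ t : ℝ, (aSeq x y n : ℂ) * (Complex.I * t) ^ n * (Real.exp (-t ^ 4) : ℂ) =
      (aSeq x y n : ℂ) * Complex.I ^ n * ((∫ t : ℝ, t ^ n * Real.exp (-t ^ 4) : ℝ) : ℂ) := by
  rw [← integral_complex_ofReal, ← integral_const_mul]
  congr 1
  funext t
  push_cast
  ring

theorem main_real (x y : ℝ) :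
    HasSum (fun n : ℕ => ((2 * ((-1 : ℝ) ^ n *
      ((1 / 4) * Real.Gamma ((2 * (n : ℝ) + 1) / 4)) * aSeq x y (2 * n)) : ℝ) : ℂ))
    (∫ t : ℝ, Complex.exp (-((t : ℂ) ^ 4 + (x : ℂ) * (t : ℂ) ^ 2)) *
        Complex.exp (Complex.I * (y : ℂ) * (t : ℂ))) := by
  have h := main_hasSum x y
  simp only [main_term] at h
  have inj : Function.Injective (fun n : ℕ => 2 * n) := fun a b hab => by
    simp only at hab
    omega
  rw [← inj.hasSum_iff] at h
  · convert h using 1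
    funext n
    simp only [Function.comp, moment_even]
    rw [pow_mul, Complex.I_sq]
    push_cast
    ring
  · intro n hn
    have : Odd n := by
      rw [← Nat.not_even_iff_odd]
      rintro ⟨k, hk⟩
      exact hn ⟨k, by simp only; omega⟩
    simp [moment_odd n this]

theorem pearcey_integral_series (x y : ℝ) :
    Integrable (fun t : ℝ =>
      Complex.exp (-((t : ℂ) ^ 4 + (x : ℂ) * (t : ℂ) ^ 2)) *
        Complex.exp (Complex.I * (y : ℂ) * (t : ℂ))) ∧
    Summable (fun n : ℕ =>
      |(-1 : ℝ) ^ n * ((1 / 4) * Real.Gamma ((2 * (n : ℝ) + 1) / 4)) * aSeq x y (2 * n)|) ∧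
    (∫ t : ℝ, Complex.exp (-((t : ℂ) ^ 4 + (x : ℂ) * (t : ℂ) ^ 2)) *
        Complex.exp (Complex.I * (y : ℂ) * (t : ℂ)))
      = ((2 * ∑' n : ℕ,
          (-1 : ℝ) ^ n * ((1 / 4) * Real.Gamma ((2 * (n : ℝ) + 1) / 4)) * aSeq x y (2 * n) : ℝ) : ℂ) := by
  have h := main_real x y
  have hsum : Summable (fun n : ℕ =>
      (-1 : ℝ) ^ n * ((1 / 4) * Real.Gamma ((2 * (n : ℝ) + 1) / 4)) * aSeq x y (2 * n)) := by
    have h1 := Complex.summable_ofReal.1 h.summable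
    exact (summable_mul_left_iff two_ne_zero).1 h1
  refine ⟨?_, hsum.abs, ?_⟩
  · refine (dom_integrable x y).mono' (Continuous.aestronglyMeasurable (by fun_prop))
      (Filter.Eventually.of_forall fun t => ?_)
    rw [norm_mul, Complex.norm_exp, Complex.norm_exp, ← Real.exp_add, ← Real.exp_add]
    apply Real.exp_le_exp.2
    have e1 : (-((t : ℂ) ^ 4 + (x : ℂ) * (t : ℂ) ^ 2)).re = -(t ^ 4 + x * t ^ 2) := by
      rw [← Complex.ofReal_re (-(t ^ 4 + x * t ^ 2))]
      push_cast
      rfl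
    have e2 : (Complex.I * (y : ℂ) * (t : ℂ)).re = 0 := by simp
    rw [e1, e2, sq_abs]
    have := mul_le_mul_of_nonneg_right (neg_abs_le x) (sq_nonneg t)
    have : 0 ≤ |y| * |t| := by positivity
    linarith
  · rw [← h.tsum_eq, ← Complex.ofReal_tsum, tsum_mul_left]
end
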